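/- Fix d ≥ 1. For polynomials γ, c ∈ ℤ[t], let φ_{(γ,c)}(x) = (x − γ)² + c, viewed as a quadratic polynomial over K = ℚ(t), and call the pair (γ, c) surjective if for every n ≥ 1 the splitting field of φ_{(γ,c)}^n over ℚ(t) has degree 2^{2^n − 1} over ℚ(t). For B ≥ 0 let P_d(B) = { f ∈ ℤ[t] : deg f ≤ d and every coefficient of f has absolute value at most B }, and let Sur_d(B) = { (γ, c) ∈ P_d(B) × P_d(B) : (γ, c) is surjective }. Then #Sur_d(B) / #(P_d(B) × P_d(B)) → 1 as B → ∞; that is, the ratio (#Sur_d(B) : ℝ) / (2B+1)^{2d+2} tends to 1 as B tends to infinity. Hence almost all quadratic polynomials of the form (x − γ)² + c with γ, c ∈ ℤ[t] of degree at most d have surjective arboreal representations over ℚ(t). -/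

import Mathlib

open Polynomial

/-- The `n`-fold iterate `φ^n` of a polynomial under composition (`φ^0 = x`). -/
noncomputable def polyIter {R : Type*} [CommRing R] (φ : Polynomial R) : ℕ → Polynomial R
  | 0 => Polynomial.X
  | n + 1 => φ.comp (polyIter φ n)

/-- The quadratic polynomial `φ_{(γ,c)}(x) = (x - γ)² + c` over `ℚ(t)` attached to a pair
`γ, c ∈ ℤ[t]`. -/
noncomputable def phiPair (γ c : Polynomial ℤ) : Polynomial (RatFunc ℚ) :=
  (X - C (algebraMap (Polynomial ℚ) (RatFunc ℚ) (γ.map (Int.castRingHom ℚ)))) ^ 2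
    + C (algebraMap (Polynomial ℚ) (RatFunc ℚ) (c.map (Int.castRingHom ℚ)))

/-- A pair `(γ, c)` is surjective if for every `n ≥ 1` the splitting field of
`φ_{(γ,c)}^n` over `ℚ(t)` has degree `2^{2^n - 1}`: the arboreal representation of
`φ_{(γ,c)}` is surjective onto `Aut(T_2)`. -/
def IsSurjPair (γ c : Polynomial ℤ) : Prop :=
  ∀ n : ℕ, 1 ≤ n →
    Module.finrank (RatFunc ℚ) ((polyIter (phiPair γ c) n).SplittingField) = 2 ^ (2 ^ n - 1)

/-- `Sur_d(B)`: the set of pairs `(γ, c) ∈ P_d(B) × P_d(B)` (integer polynomials of degree at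
most `d` with coefficients of absolute value at most `B`) that are surjective. -/
def SurSet (d B : ℕ) : Set (Polynomial ℤ × Polynomial ℤ) :=
  {pc | pc.1.natDegree ≤ d ∧ pc.2.natDegree ≤ d ∧
    (∀ i, |pc.1.coeff i| ≤ (B : ℤ)) ∧ (∀ i, |pc.2.coeff i| ≤ (B : ℤ)) ∧
    IsSurjPair pc.1 pc.2}


section Kummer
variable {K Ω : Type*} [Field K] [Field Ω] [Algebra K Ω]

/-- `x` is the square of an element of `L`. -/
def SqIn (L : IntermediateField K Ω) (x : Ω) : Prop := ∃ y ∈ L, y ^ 2 = x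

lemma mem_sup_simple (L : IntermediateField K Ω) (s : Ω) (hs : s ^ 2 ∈ L) (x : Ω)
    (hx : x ∈ L ⊔ IntermediateField.adjoin K {s}) : ∃ u ∈ L, ∃ v ∈ L, x = u + v * s := by
  have e : L ⊔ IntermediateField.adjoin K {s}
      = (IntermediateField.adjoin L {s}).restrictScalars K := by
    rw [IntermediateField.restrictScalars_adjoin, IntermediateField.adjoin_union,
      IntermediateField.adjoin_self]
  rw [e, IntermediateField.mem_restrictScalars] at hx
  have hsint : IsIntegral L s := by
    refine ⟨X ^ 2 - C ⟨s ^ 2, hs⟩, monic_X_pow_sub_C _ two_ne_zero, ?_⟩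
    simp
  rw [← IntermediateField.mem_toSubalgebra,
    IntermediateField.adjoin_simple_toSubalgebra_of_isAlgebraic hsint.isAlgebraic] at hx
  induction hx using Algebra.adjoin_induction with
  | mem x hx =>
    obtain rfl : x = s := by simpa using hx
    exact ⟨0, L.zero_mem, 1, L.one_mem, by simp⟩
  | algebraMap r => exact ⟨r, r.2, 0, L.zero_mem, by simp⟩
  | add x y _ _ hx hy =>
    obtain ⟨u, hu, v, hv, rfl⟩ := hx
    obtain ⟨u', hu', v', hv', rfl⟩ := hy
    exact ⟨u + u', L.add_mem hu hu', v + v', L.add_mem hv hv', by ring⟩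
  | mul x y _ _ hx hy =>
    obtain ⟨u, hu, v, hv, rfl⟩ := hx
    obtain ⟨u', hu', v', hv', rfl⟩ := hy
    exact ⟨u * u' + v * v' * s ^ 2,
      L.add_mem (L.mul_mem hu hu') (L.mul_mem (L.mul_mem hv hv') hs),
      u * v' + v * u', L.add_mem (L.mul_mem hu hv') (L.mul_mem hv hu'), by ring⟩

lemma finrank_sup_simple (L : IntermediateField K Ω) (s : Ω) (hs : s ^ 2 ∈ L) (hn : s ∉ L) :
    Module.finrank K (L ⊔ IntermediateField.adjoin K {s} : IntermediateField K Ω)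
      = 2 * Module.finrank K L := by
  have e : L ⊔ IntermediateField.adjoin K {s}
      = (IntermediateField.adjoin L {s}).restrictScalars K := by
    rw [IntermediateField.restrictScalars_adjoin, IntermediateField.adjoin_union,
      IntermediateField.adjoin_self]
  rw [e]
  have hm : (X ^ 2 - C (⟨s ^ 2, hs⟩ : L)).Monic := monic_X_pow_sub_C _ two_ne_zero
  have hev : aeval s (X ^ 2 - C (⟨s ^ 2, hs⟩ : L)) = 0 := by simp
  have hsint : IsIntegral L s := ⟨_, hm, hev⟩
  have h1 : (minpoly L s).natDegree ≤ 2 := by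
    have := natDegree_le_of_dvd (minpoly.dvd L s hev) hm.ne_zero
    rwa [natDegree_X_pow_sub_C] at this
  have h2 : 2 ≤ (minpoly L s).natDegree := by
    rw [minpoly.two_le_natDegree_iff hsint]
    rintro ⟨y, rfl⟩
    exact hn y.2
  have h3 := IntermediateField.adjoin.finrank hsint
  have h4 : Module.finrank K L * Module.finrank L (IntermediateField.adjoin L {s})
    = Module.finrank K (IntermediateField.adjoin L {s}) := Module.finrank_mul_finrank _ _ _
  change Module.finrank K (IntermediateField.adjoin L {s}) = _
  rw [← h4, h3]
  have : (minpoly L s).natDegree = 2 := le_antisymm h1 h2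
  rw [this, mul_comm]

lemma sqIn_sup_simple (h2 : (2 : Ω) ≠ 0) (L : IntermediateField K Ω) (s : Ω) (hs : s ^ 2 ∈ L)
    (x : Ω) (hx : x ∈ L) (h : SqIn (L ⊔ IntermediateField.adjoin K {s}) x) :
    SqIn L x ∨ SqIn L (x * s ^ 2) := by
  obtain ⟨y, hy, rfl⟩ := h
  obtain ⟨u, hu, v, hv, rfl⟩ := mem_sup_simple L s hs y hy
  by_cases hsL : s ∈ L
  · exact Or.inl ⟨_, L.add_mem hu (L.mul_mem hv hsL), rfl⟩
  by_cases hu0 : u = 0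
  · subst hu0
    exact Or.inr ⟨v * s ^ 2, L.mul_mem hv hs, by ring⟩
  by_cases hv0 : v = 0
  · subst hv0
    exact Or.inl ⟨u, hu, by ring⟩
  exfalso
  apply hsL
  have h2L : (2 : Ω) ∈ L := by exact_mod_cast L.natCast_mem 2
  have : s = ((u + v * s) ^ 2 - u ^ 2 - v ^ 2 * s ^ 2) / (2 * u * v) := by
    field_simp; ring
  rw [this]
  exact L.div_mem (L.sub_mem (L.sub_mem hx (pow_mem hu 2)) (L.mul_mem (pow_mem hv 2) hs))
    (L.mul_mem (L.mul_mem h2L hu) hv)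

lemma sup_insert [DecidableEq Ω] (L : IntermediateField K Ω) (q : Ω → Ω) (r : Ω) (S : Finset Ω) :
    L ⊔ IntermediateField.adjoin K (q '' (insert r S : Finset Ω))
      = (L ⊔ IntermediateField.adjoin K (q '' S)) ⊔ IntermediateField.adjoin K {q r} := by
  rw [Finset.coe_insert, Set.image_insert_eq, sup_assoc, ← IntermediateField.adjoin_union,
    Set.union_singleton]

lemma kummer_sq [DecidableEq Ω] (h2 : (2 : Ω) ≠ 0) (L : IntermediateField K Ω) (q : Ω → Ω)
    (S : Finset Ω) : (∀ r ∈ S, q r ^ 2 ∈ L) → ∀ x ∈ L,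
    SqIn (L ⊔ IntermediateField.adjoin K (q '' S)) x →
    ∃ T ⊆ S, SqIn L (x * ∏ r ∈ T, q r ^ 2) := by
  induction S using Finset.induction_on with
  | empty =>
    intro _ x hx h
    refine ⟨∅, by simp, ?_⟩
    simpa using h
  | insert r S hr ih =>
    intro hS x hx h
    rw [sup_insert] at h
    have hS' : ∀ r ∈ S, q r ^ 2 ∈ L := fun t ht => hS t (Finset.mem_insert_of_mem ht)
    have hle : L ≤ L ⊔ IntermediateField.adjoin K (q '' S) := le_sup_left
    have hrL := hS r (Finset.mem_insert_self _ _)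
    rcases sqIn_sup_simple h2 _ _ (hle hrL) x (hle hx) h with h | h
    · obtain ⟨T, hT, h⟩ := ih hS' x hx h
      exact ⟨T, hT.trans (Finset.subset_insert _ _), h⟩
    · obtain ⟨T, hT, h⟩ := ih hS' _ (L.mul_mem hx hrL) h
      refine ⟨insert r T, Finset.insert_subset_insert _ hT, ?_⟩
      rw [Finset.prod_insert (fun hh => hr (hT hh)), ← mul_assoc]
      exact h

lemma kummer_deg [DecidableEq Ω] (h2 : (2 : Ω) ≠ 0) (L : IntermediateField K Ω) (q : Ω → Ω)
    (S : Finset Ω) : (∀ r ∈ S, q r ^ 2 ∈ L) →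
    (∀ T ⊆ S, T.Nonempty → ¬ SqIn L (∏ r ∈ T, q r ^ 2)) →
    Module.finrank K (L ⊔ IntermediateField.adjoin K (q '' S) : IntermediateField K Ω)
      = 2 ^ S.card * Module.finrank K L := by
  induction S using Finset.induction_on with
  | empty =>
    intro _ _
    have e : L ⊔ IntermediateField.adjoin K (q '' ((∅ : Finset Ω) : Set Ω)) = L := by simp
    rw [e]
    simp
  | insert r S hr ih =>
    intro hS hT
    have hS' : ∀ r ∈ S, q r ^ 2 ∈ L := fun t ht => hS t (Finset.mem_insert_of_mem ht)
    have hle : L ≤ L ⊔ IntermediateField.adjoin K (q '' S) := le_sup_left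
    have hrL := hS r (Finset.mem_insert_self _ _)
    rw [sup_insert, finrank_sup_simple _ _ (hle hrL), ih hS', Finset.card_insert_of_notMem hr]
    · ring
    · exact fun T hTS => hT T (hTS.trans (Finset.subset_insert _ _))
    · intro hq
      obtain ⟨T, hTS, h⟩ := kummer_sq h2 L q S hS' (q r ^ 2) hrL ⟨q r, hq, rfl⟩
      refine hT (insert r T) (Finset.insert_subset_insert _ hTS) (by simp) ?_
      rwa [Finset.prod_insert (fun hh => hr (hTS hh))]
end Kummer


section Tower
variable {K Ω : Type*} [Field K] [Field Ω] [Algebra K Ω] [IsAlgClosed Ω]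

/-- A chosen square root. -/
noncomputable def sqrtOf (x : Ω) : Ω := (IsAlgClosed.exists_pow_nat_eq x (n := 2) two_pos).choose

lemma sqrtOf_sq (x : Ω) : sqrtOf x ^ 2 = x :=
  (IsAlgClosed.exists_pow_nat_eq x (n := 2) two_pos).choose_spec

/-- The quadratic map. -/
def quadMap (g c x : Ω) : Ω := (x - g) ^ 2 + c

open Classical in
/-- Level `n` of the tree of iterated preimages of `0`. -/
noncomputable def treeLevel (g c : Ω) : ℕ → Finset Ω
  | 0 => {0}
  | n + 1 => (treeLevel g c n).biUnion fun r => {g + sqrtOf (r - c), g - sqrtOf (r - c)}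

lemma mem_treeLevel_succ (g c : Ω) (n : ℕ) (s : Ω) :
    s ∈ treeLevel g c (n + 1) ↔ quadMap g c s ∈ treeLevel g c n := by
  classical
  simp only [treeLevel, Finset.mem_biUnion, Finset.mem_insert, Finset.mem_singleton]
  constructor
  · rintro ⟨r, hr, h⟩
    have : quadMap g c s = r := by
      have := sqrtOf_sq (r - c)
      unfold quadMap
      rcases h with rfl | rfl
      · linear_combination this
      · linear_combination this
    rwa [this]
  · intro h
    refine ⟨_, h, ?_⟩
    have := sqrtOf_sq (quadMap g c s - c)
    have h2 : (s - g - sqrtOf (quadMap g c s - c)) * (s - g + sqrtOf (quadMap g c s - c)) = 0 := by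
      have e : quadMap g c s - c = (s - g) ^ 2 := by unfold quadMap; ring
      linear_combination -e - this
    rcases mul_eq_zero.mp h2 with h | h
    · left; linear_combination h
    · right; linear_combination h

lemma treeLevel_fib_disj (g c : Ω) (n : ℕ) [DecidableEq Ω] :
    Set.PairwiseDisjoint (treeLevel g c n : Set Ω)
      (fun r => ({g + sqrtOf (r - c), g - sqrtOf (r - c)} : Finset Ω)) := by
  intro r _ r' _ hne
  rw [Function.onFun, Finset.disjoint_left]
  intro s hs hs'
  apply hne
  have h1 := sqrtOf_sq (r - c)
  have h2 := sqrtOf_sq (r' - c)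
  have e1 : (s - g) ^ 2 = r - c := by
    rcases Finset.mem_insert.mp hs with rfl | h
    · linear_combination h1
    · rw [Finset.mem_singleton.mp h]; linear_combination h1
  have e2 : (s - g) ^ 2 = r' - c := by
    rcases Finset.mem_insert.mp hs' with rfl | h
    · linear_combination h2
    · rw [Finset.mem_singleton.mp h]; linear_combination h2
  linear_combination e2 - e1

lemma sqrt_pair_ne (h2 : (2 : Ω) ≠ 0) (g c r : Ω) (h : r - c ≠ 0) :
    g + sqrtOf (r - c) ≠ g - sqrtOf (r - c) := by
  intro e
  have : 2 * sqrtOf (r - c) = 0 := by linear_combination e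
  have := (mul_eq_zero.mp this).resolve_left h2
  have h3 := sqrtOf_sq (r - c)
  rw [this] at h3
  exact h (by rw [← h3]; simp)

lemma treeLevel_card_succ (h2 : (2 : Ω) ≠ 0) (g c : Ω) (n : ℕ)
    (h : ∀ r ∈ treeLevel g c n, r - c ≠ 0) :
    (treeLevel g c (n + 1)).card = 2 * (treeLevel g c n).card := by
  classical
  rw [treeLevel, Finset.card_biUnion]
  · rw [Finset.sum_congr rfl (g := fun _ => 2)]
    · simp [mul_comm]
    · intro r hr
      rw [Finset.card_pair (sqrt_pair_ne h2 g c r (h r hr))]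
  · exact treeLevel_fib_disj g c n

lemma treeLevel_prod_succ (h2 : (2 : Ω) ≠ 0) (g c y : Ω) (n : ℕ)
    (h : ∀ r ∈ treeLevel g c n, r - c ≠ 0) :
    ∏ r ∈ treeLevel g c (n + 1), (r - y) = ∏ r ∈ treeLevel g c n, (quadMap g c y - r) := by
  classical
  rw [treeLevel, Finset.prod_biUnion (treeLevel_fib_disj g c n)]
  refine Finset.prod_congr rfl fun r hr => ?_
  rw [Finset.prod_pair (sqrt_pair_ne h2 g c r (h r hr))]
  have h3 := sqrtOf_sq (r - c)
  unfold quadMap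
  linear_combination -h3

lemma treeLevel_prod (h2 : (2 : Ω) ≠ 0) (g c : Ω) (n : ℕ)
    (h : ∀ m < n + 1, ∀ r ∈ treeLevel g c m, r - c ≠ 0) :
    ∀ y, ∏ r ∈ treeLevel g c (n + 1), (r - y) = (quadMap g c)^[n + 1] y := by
  induction n with
  | zero =>
    intro y
    rw [treeLevel_prod_succ h2 g c y 0 (h 0 (by omega))]
    simp [treeLevel]
  | succ n ih =>
    intro y
    rw [treeLevel_prod_succ h2 g c y (n + 1) (h _ (by omega)), Function.iterate_succ_apply,
      ← ih (fun m hm => h m (by omega))]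
    have hc := treeLevel_card_succ h2 g c n (h n (by omega))
    have : ∀ z : Ω, ∏ r ∈ treeLevel g c (n + 1), (z - r)
        = (∏ r ∈ treeLevel g c (n + 1), (-1 : Ω)) * ∏ r ∈ treeLevel g c (n + 1), (r - z) := by
      intro z
      rw [← Finset.prod_mul_distrib]
      exact Finset.prod_congr rfl fun r _ => by ring
    rw [this, Finset.prod_const, hc, pow_mul]
    simp

/-- The field generated by level `n`. -/
noncomputable def treeField (K : Type*) {Ω : Type*} [Field K] [Field Ω] [Algebra K Ω]
    [IsAlgClosed Ω] (g c : Ω) (n : ℕ) : IntermediateField K Ω :=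
  IntermediateField.adjoin K (treeLevel g c n : Set Ω)

lemma treeLevel_mem_field (g c : Ω) (n : ℕ) (r : Ω) (hr : r ∈ treeLevel g c n) :
    r ∈ treeField K g c n := IntermediateField.subset_adjoin K _ hr

lemma treeField_succ (g c : K) (n : ℕ) :
    treeField K (algebraMap K Ω g) (algebraMap K Ω c) (n + 1)
      = treeField K (algebraMap K Ω g) (algebraMap K Ω c) n ⊔ IntermediateField.adjoin K
        ((fun r => sqrtOf (r - algebraMap K Ω c)) ''
          (treeLevel (algebraMap K Ω g) (algebraMap K Ω c) n : Set Ω)) := by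
  classical
  set g' := algebraMap K Ω g
  set c' := algebraMap K Ω c
  have hg : ∀ L : IntermediateField K Ω, g' ∈ L := fun L => L.algebraMap_mem g
  have hc : ∀ L : IntermediateField K Ω, c' ∈ L := fun L => L.algebraMap_mem c
  apply le_antisymm
  · rw [treeField, IntermediateField.adjoin_le_iff]
    intro s hs
    simp only [treeLevel, Finset.coe_biUnion, Set.mem_iUnion] at hs
    obtain ⟨r, hr, hs⟩ := hs
    have hq : sqrtOf (r - c') ∈ treeField K g' c' n ⊔ IntermediateField.adjoin K
        ((fun r => sqrtOf (r - c')) '' (treeLevel g' c' n : Set Ω)) :=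
      (le_sup_right : _ ≤ treeField K g' c' n ⊔ _)
        (IntermediateField.subset_adjoin K _ ⟨r, hr, rfl⟩)
    simp only [Finset.coe_insert, Finset.coe_singleton, Set.mem_insert_iff,
      Set.mem_singleton_iff] at hs
    rcases hs with rfl | rfl
    · exact add_mem (hg _) hq
    · exact sub_mem (hg _) hq
  · have key : ∀ r ∈ treeLevel g' c' n, g' + sqrtOf (r - c') ∈ treeLevel g' c' (n + 1) := by
      intro r hr
      simp only [treeLevel, Finset.mem_biUnion]
      exact ⟨r, hr, by simp⟩
    refine sup_le ?_ ?_
    · rw [treeField, IntermediateField.adjoin_le_iff]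
      intro r hr
      have h1 := treeLevel_mem_field (K := K) _ _ _ _ (key r hr)
      have : r = (g' + sqrtOf (r - c') - g') ^ 2 + c' := by
        have := sqrtOf_sq (r - c')
        linear_combination -this
      rw [this]
      exact add_mem (pow_mem (sub_mem h1 (hg _)) 2) (hc _)
    · rw [IntermediateField.adjoin_le_iff]
      rintro _ ⟨r, hr, rfl⟩
      have h1 := treeLevel_mem_field (K := K) _ _ _ _ (key r hr)
      have : sqrtOf (r - c') = (g' + sqrtOf (r - c')) - g' := by ring
      change sqrtOf (r - c') ∈ _
      rw [this]
      exact sub_mem h1 (hg _)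

lemma treeLevel_map (g c : K) (n : ℕ) (σ : Ω ≃ₐ[K] Ω) : ∀ r : Ω,
    r ∈ treeLevel (algebraMap K Ω g) (algebraMap K Ω c) n →
    σ r ∈ treeLevel (algebraMap K Ω g) (algebraMap K Ω c) n := by
  induction n with
  | zero => intro r hr; simp only [treeLevel, Finset.mem_singleton] at hr ⊢; simp [hr]
  | succ n ih =>
    intro r hr
    rw [mem_treeLevel_succ] at hr ⊢
    have := ih _ hr
    simpa [quadMap] using this

lemma treeField_map (g c : K) (n : ℕ) (σ : Ω ≃ₐ[K] Ω) (x : Ω)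
    (hx : x ∈ treeField K (algebraMap K Ω g) (algebraMap K Ω c) n) :
    σ x ∈ treeField K (algebraMap K Ω g) (algebraMap K Ω c) n := by
  have : treeField K (algebraMap K Ω g) (algebraMap K Ω c) n ≤
      (treeField K (algebraMap K Ω g) (algebraMap K Ω c) n).comap (σ : Ω →ₐ[K] Ω) := by
    conv_lhs => rw [treeField]
    rw [IntermediateField.adjoin_le_iff]
    intro r hr
    exact treeLevel_mem_field _ _ _ _ (treeLevel_map g c n σ r hr)
  exact this hx

lemma sqIn_map (g c : K) (n : ℕ) (σ : Ω ≃ₐ[K] Ω) (x : Ω)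
    (hx : SqIn (treeField K (algebraMap K Ω g) (algebraMap K Ω c) n) x) :
    SqIn (treeField K (algebraMap K Ω g) (algebraMap K Ω c) n) (σ x) := by
  obtain ⟨y, hy, rfl⟩ := hx
  exact ⟨σ y, treeField_map g c n σ y hy, by simp⟩
end Tower


section FixedSubset
open scoped Pointwise
lemma fixed_subset {G α : Type*} [Group G] [MulAction G α] [DecidableEq α] (S : Finset α)
    (hpow : ∀ g : G, ∃ k : ℕ, ∀ a ∈ S, g ^ (2 ^ k) • a = a)
    (V : Set (Finset α)) (hVS : ∀ T ∈ V, T ⊆ S) (hV0 : ∅ ∈ V)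
    (hVs : ∀ T ∈ V, ∀ T' ∈ V, symmDiff T T' ∈ V)
    (hVg : ∀ g : G, ∀ T ∈ V, g • T ∈ V) (T0 : Finset α) (hT0 : T0 ∈ V) (hne : T0.Nonempty) :
    ∃ T ∈ V, T.Nonempty ∧ ∀ g : G, ∀ a ∈ T, g • a ∈ T := by
  classical
  let W : SubMulAction G (Finset α) := { carrier := V, smul_mem' := fun g T hT => hVg g T hT }
  have hVfin : V.Finite := (S.powerset.finite_toSet).subset fun T hT => by
    simpa using hVS T hT
  have : Finite W := hVfin
  have : Fintype W := Fintype.ofFinite _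
  let H := (MulAction.toPermHom G W).range
  have hP : IsPGroup 2 H := by
    rintro ⟨_, g, rfl⟩
    obtain ⟨k, hk⟩ := hpow g
    refine ⟨k, ?_⟩
    apply Subtype.ext
    simp only [SubgroupClass.coe_pow, OneMemClass.coe_one]
    rw [← map_pow]
    ext1 T
    apply Subtype.ext
    change g ^ 2 ^ k • (T : Finset α) = T
    have : ∀ a ∈ (T : Finset α), g ^ 2 ^ k • a = a := fun a ha => hk a (hVS _ T.2 ha)
    change Finset.image _ _ = _
    rw [Finset.image_congr (g := id) (fun a ha => this a ha), Finset.image_id]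
  have hcard : 2 ∣ Nat.card W := by
    rw [Nat.card_eq_fintype_card]
    have h0 : ∑ _T ∈ (Finset.univ : Finset W), (1 : ZMod 2) = 0 := by
      refine Finset.sum_involution (fun T _ => ⟨symmDiff (T : Finset α) T0, hVs _ T.2 _ hT0⟩)
        ?_ ?_ ?_ ?_
      · intros; decide
      · intro T _ _ h
        have h1 : symmDiff (T : Finset α) T0 = T := congrArg Subtype.val h
        rw [symmDiff_eq_left] at h1
        exact hne.ne_empty h1
      · simp
      · intro T _
        apply Subtype.ext
        simp
    simp only [Finset.sum_const, Finset.card_univ, nsmul_eq_mul, mul_one] at h0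
    exact (ZMod.natCast_eq_zero_iff _ _).mp h0
  have : Fact (Nat.Prime 2) := ⟨Nat.prime_two⟩
  have hfix : (⟨∅, hV0⟩ : W) ∈ MulAction.fixedPoints H W := by
    rintro ⟨_, g, rfl⟩
    apply Subtype.ext
    change g • (∅ : Finset α) = ∅
    simp
  obtain ⟨T, hT, hTne⟩ := hP.exists_fixed_point_of_prime_dvd_card_of_fixed_point W hcard hfix
  refine ⟨T, T.2, ?_, ?_⟩
  · rw [Finset.nonempty_iff_ne_empty]
    intro h
    exact hTne (Subtype.ext h.symm)
  · intro g a ha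
    have h1 := hT ⟨_, g, rfl⟩
    have h2 : g • (T : Finset α) = T := congrArg Subtype.val h1
    rw [← h2]
    exact Finset.smul_mem_smul_finset ha
end FixedSubset

section Stoll
variable {K Ω : Type*} [Field K] [Field Ω] [Algebra K Ω] [IsAlgClosed Ω]

lemma prod_symmDiff_sq [DecidableEq Ω] (L : IntermediateField K Ω) (f : Ω → Ω) (x y : Ω) (A B : Finset Ω)
    (hA : SqIn L (x * ∏ r ∈ A, f r)) (hB : SqIn L (y * ∏ r ∈ B, f r))
    (hf : ∀ r ∈ A ∩ B, f r ∈ L) (hf0 : ∀ r ∈ A ∩ B, f r ≠ 0) :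
    SqIn L (x * y * ∏ r ∈ symmDiff A B, f r) := by
  obtain ⟨u, hu, hu2⟩ := hA
  obtain ⟨v, hv, hv2⟩ := hB
  have hP : ∏ r ∈ A ∩ B, f r ∈ L := prod_mem hf
  have hP0 : ∏ r ∈ A ∩ B, f r ≠ 0 := Finset.prod_ne_zero_iff.mpr hf0
  refine ⟨u * v / ∏ r ∈ A ∩ B, f r, L.div_mem (L.mul_mem hu hv) hP, ?_⟩
  have e1 : (∏ r ∈ symmDiff A B, f r) * ∏ r ∈ A ∩ B, f r = ∏ r ∈ A ∪ B, f r := by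
    rw [← Finset.prod_union]
    · congr 1
      ext a; simp [Finset.mem_symmDiff]; tauto
    · rw [Finset.disjoint_left]; intro a; simp [Finset.mem_symmDiff]; tauto
  have e2 := Finset.prod_union_inter (s₁ := A) (s₂ := B) (f := f)
  rw [div_pow, mul_pow, hu2, hv2, div_eq_iff (pow_ne_zero 2 hP0)]
  linear_combination -(x*y)*e2 - x * y * (∏ r ∈ A ∩ B, f r) * e1

variable [Algebra.IsAlgebraic K Ω]

lemma tree_pow (g c : K) (n : ℕ) (m : ℕ)
    (hsep : Algebra.IsSeparable K Ω)
    (hdeg : Module.finrank K (treeField K (algebraMap K Ω g) (algebraMap K Ω c) n) = 2 ^ m)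
    (σ : Ω ≃ₐ[K] Ω) : ∀ a ∈ treeLevel (algebraMap K Ω g) (algebraMap K Ω c) n,
      (σ ^ (2 ^ m)) a = a := by
  set L := treeField K (algebraMap K Ω g) (algebraMap K Ω c) n with hL
  have : Normal K L := by
    have : IsAlgClosure K Ω := ⟨inferInstance, inferInstance⟩
    have : Normal K Ω := IsAlgClosure.normal K Ω
    rw [IntermediateField.normal_iff_forall_map_le']
    intro τ
    rintro _ ⟨x, hx, rfl⟩
    exact treeField_map g c n τ x hx
  have : FiniteDimensional K L := Module.finite_of_finrank_pos (by rw [hdeg]; positivity)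
  have : IsGalois K L := {}
  intro a ha
  have haL : a ∈ L := treeLevel_mem_field _ _ _ _ ha
  have h1 : (AlgEquiv.restrictNormalHom L σ) ^ (2 ^ m) = 1 := by
    rw [← hdeg, ← IsGalois.card_aut_eq_finrank]
    exact pow_card_eq_one'
  rw [← map_pow] at h1
  have h2 := AlgEquiv.restrictNormalHom_apply L (σ ^ (2 ^ m)) ⟨a, haL⟩
  rw [h1] at h2
  exact h2.symm

/-- The orbit of `g`. -/
def orb {R : Type*} [CommRing R] (g c : R) : ℕ → R
  | 0 => g
  | n + 1 => (orb g c n - g) ^ 2 + c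

/-- Stoll's sequence. -/
def dlt {R : Type*} [CommRing R] (g c : R) : ℕ → R
  | 0 => -c
  | n + 1 => orb g c (n + 2)

lemma orb_iter (g c : Ω) (n : ℕ) : (quadMap g c)^[n] g = orb g c n := by
  induction n with
  | zero => rfl
  | succ n ih => rw [Function.iterate_succ_apply', ih]; rfl

lemma orb_map {R S : Type*} [CommRing R] [CommRing S] (f : R →+* S) (g c : R) (n : ℕ) :
    f (orb g c n) = orb (f g) (f c) n := by
  induction n with
  | zero => rfl
  | succ n ih => simp [orb, ih]

lemma dlt_map {R S : Type*} [CommRing R] [CommRing S] (f : R →+* S) (g c : R) (n : ℕ) :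
    f (dlt g c n) = dlt (f g) (f c) n := by
  cases n with
  | zero => simp [dlt]
  | succ n => simp [dlt, orb_map]

lemma tree_prod_dlt (h2 : (2 : Ω) ≠ 0) (g c : Ω) (n : ℕ)
    (h : ∀ m < n, ∀ r ∈ treeLevel g c m, r - c ≠ 0) :
    ∏ r ∈ treeLevel g c n, (r - c) = dlt g c n := by
  cases n with
  | zero => simp [treeLevel, dlt]
  | succ n =>
    rw [treeLevel_prod h2 g c n h, dlt, ← orb_iter, Function.iterate_succ_apply (n := n + 1)]
    simp [quadMap]
end Stoll


section Stoll2
variable {K Ω : Type*} [Field K] [Field Ω] [Algebra K Ω] [IsAlgClosed Ω]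
  [Algebra.IsAlgebraic K Ω]

/-- Induction package for level `n`. -/
structure TreeGood (K : Type*) {Ω : Type*} [Field K] [Field Ω] [Algebra K Ω] [IsAlgClosed Ω]
    (g c : K) (n : ℕ) : Prop where
  card : (treeLevel (algebraMap K Ω g) (algebraMap K Ω c) n).card = 2 ^ n
  deg : Module.finrank K (treeField K (algebraMap K Ω g) (algebraMap K Ω c) n) = 2 ^ (2 ^ n - 1)
  trans : ∀ r ∈ treeLevel (algebraMap K Ω g) (algebraMap K Ω c) n,
    ∀ s ∈ treeLevel (algebraMap K Ω g) (algebraMap K Ω c) n, ∃ σ : Ω ≃ₐ[K] Ω, σ r = s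
  sq : ∀ x : K, SqIn (treeField K (algebraMap K Ω g) (algebraMap K Ω c) n) (algebraMap K Ω x) →
    ∃ I ⊆ Finset.range n, IsSquare (x * ∏ i ∈ I, dlt g c i)
  ne : ∀ m < n, ∀ r ∈ treeLevel (algebraMap K Ω g) (algebraMap K Ω c) m, r - algebraMap K Ω c ≠ 0

lemma treeGood_zero (g c : K) : TreeGood K (Ω := Ω) g c 0 := by
  have hbot : treeField K (algebraMap K Ω g) (algebraMap K Ω c) 0 = ⊥ := by
    simp [treeField, treeLevel]
  refine ⟨by simp [treeLevel], ?_, ?_, ?_, by simp⟩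
  · rw [hbot]; simp
  · intro r hr s hs
    simp only [treeLevel, Finset.mem_singleton] at hr hs
    exact ⟨1, by simp [hr, hs]⟩
  · intro x hx
    rw [hbot] at hx
    obtain ⟨y, hy, hxy⟩ := hx
    obtain ⟨z, rfl⟩ := IntermediateField.mem_bot.mp hy
    refine ⟨∅, by simp, z, ?_⟩
    rw [← map_pow] at hxy
    have := (algebraMap K Ω).injective hxy
    simp [← this, sq]

/-- an automorphism fixing `L` and swapping the sign of a square root not in `L` -/
lemma exists_sign_swap (L : IntermediateField K Ω) (s : Ω) (hs : s ^ 2 ∈ L) (hn : s ∉ L) :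
    ∃ τ : Ω ≃ₐ[K] Ω, (∀ x ∈ L, τ x = x) ∧ τ s = -s := by
  have hm : (X ^ 2 - C (⟨s ^ 2, hs⟩ : L)).Monic := monic_X_pow_sub_C _ two_ne_zero
  have hev : aeval s (X ^ 2 - C (⟨s ^ 2, hs⟩ : L)) = 0 := by simp
  have hsint : IsIntegral L s := ⟨_, hm, hev⟩
  have h2 : 2 ≤ (minpoly L s).natDegree := by
    rw [minpoly.two_le_natDegree_iff hsint]
    rintro ⟨y, rfl⟩
    exact hn y.2
  have hmin : X ^ 2 - C (⟨s ^ 2, hs⟩ : L) = minpoly L s := by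
    refine eq_of_monic_of_dvd_of_natDegree_le (minpoly.monic hsint) hm (minpoly.dvd L s hev) ?_
    rwa [natDegree_X_pow_sub_C]
  have h3 : aeval (-s) (minpoly L s) = 0 := by rw [← hmin]; simp
  have : Algebra.IsAlgebraic L Ω := Algebra.IsAlgebraic.tower_top (K := K) L
  have : IsAlgClosure L Ω := ⟨inferInstance, inferInstance⟩
  have : Normal L Ω := IsAlgClosure.normal L Ω
  obtain ⟨τ, hτ⟩ := minpoly.exists_algEquiv_of_root' (Algebra.IsAlgebraic.isAlgebraic s) h3
  refine ⟨τ.restrictScalars K, ?_, hτ⟩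
  intro x hx
  exact τ.commutes ⟨x, hx⟩


lemma treeGood_succ [CharZero K] (g c : K) (n : ℕ)
    (hyp : ∀ I : Finset ℕ, I.Nonempty → ¬ IsSquare (∏ i ∈ I, dlt g c i))
    (P : TreeGood K (Ω := Ω) g c n) : TreeGood K (Ω := Ω) g c (n + 1) := by
  classical
  have : CharZero Ω := charZero_of_injective_algebraMap (algebraMap K Ω).injective
  have h2 : (2 : Ω) ≠ 0 := two_ne_zero
  set g' := algebraMap K Ω g with hg'
  set c' := algebraMap K Ω c with hc'
  set S := treeLevel g' c' n with hS
  set L := treeField K g' c' n with hL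
  have hprod : ∏ r ∈ S, (r - c') = algebraMap K Ω (dlt g c n) := by
    rw [tree_prod_dlt h2 g' c' n P.ne, dlt_map]
  have hd0 : dlt g c n ≠ 0 := by
    intro h
    apply hyp {n} (by simp)
    simp [h]
  have hne : ∀ r ∈ S, r - c' ≠ 0 := by
    have : ∏ r ∈ S, (r - c') ≠ 0 := by
      rw [hprod]; simpa using hd0
    exact Finset.prod_ne_zero_iff.mp this
  have hrL : ∀ r ∈ S, r - c' ∈ L := fun r hr =>
    sub_mem (treeLevel_mem_field _ _ _ _ hr) (L.algebraMap_mem c)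
  have hdn : ¬ SqIn L (∏ r ∈ S, (r - c')) := by
    rw [hprod]
    intro h
    obtain ⟨I, hI, hsq⟩ := P.sq _ h
    have hn : n ∉ I := fun h => by simpa using hI h
    rw [← Finset.prod_insert hn] at hsq
    exact hyp _ (by simp) hsq
  have hSσ : ∀ (σ : Ω ≃ₐ[K] Ω) (T : Finset Ω), T ⊆ S → T.image σ ⊆ S := by
    intro σ T hT x hx
    obtain ⟨y, hy, rfl⟩ := Finset.mem_image.mp hx
    exact treeLevel_map g c n σ y (hT hy)
  have hsqσ : ∀ (σ : Ω ≃ₐ[K] Ω) (T : Finset Ω) (x : K),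
      SqIn L (algebraMap K Ω x * ∏ r ∈ T, (r - c')) →
      SqIn L (algebraMap K Ω x * ∏ r ∈ T.image σ, (r - c')) := by
    intro σ T x h
    have := sqIn_map g c n σ _ h
    rw [Finset.prod_image (fun a _ b _ h => σ.injective h)]
    simpa [hc'] using this
  have hinv : ∀ T ⊆ S, T.Nonempty → (∀ σ : Ω ≃ₐ[K] Ω, ∀ a ∈ T, σ a ∈ T) → T = S := by
    intro T hT ⟨a, ha⟩ h
    refine Finset.Subset.antisymm hT fun s hs => ?_
    obtain ⟨σ, rfl⟩ := P.trans a (hT ha) s hs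
    exact h σ a ha
  have hV : ∀ T ⊆ S, T.Nonempty → ¬ SqIn L (∏ r ∈ T, (r - c')) := by
    intro T0 hT0 hT0n hT0s
    obtain ⟨T, hT, hTn, hTi⟩ := fixed_subset (G := Ω ≃ₐ[K] Ω) S
      (fun σ => ⟨_, tree_pow g c n _ inferInstance P.deg σ⟩)
      {T | T ⊆ S ∧ SqIn L (∏ r ∈ T, (r - c'))} (fun T hT => hT.1)
      ⟨by simp, 1, L.one_mem, by simp⟩
      (by
        rintro T ⟨hT, hTs⟩ T' ⟨hT', hTs'⟩
        refine ⟨fun x hx => ?_, ?_⟩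
        · rw [Finset.mem_symmDiff] at hx
          rcases hx with hx | hx
          · exact hT hx.1
          · exact hT' hx.1
        · have := prod_symmDiff_sq L (fun r => r - c') 1 1 T T' (by simpa using hTs)
            (by simpa using hTs') (fun r hr => hrL r (hT (Finset.mem_inter.mp hr).1))
            (fun r hr => hne r (hT (Finset.mem_inter.mp hr).1))
          simpa using this)
      (by
        rintro σ T ⟨hT, hTs⟩
        refine ⟨hSσ σ T hT, ?_⟩
        have := hsqσ σ T 1 (by simpa using hTs)
        rw [map_one, one_mul] at this
        exact this) T0 ⟨hT0, hT0s⟩ hT0n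
    have := hinv T hT.1 hTn (fun σ a ha => hTi σ a ha)
    rw [this] at hT
    exact hdn hT.2
  have hq2 : ∀ r, sqrtOf (r - c') ^ 2 = r - c' := fun r => sqrtOf_sq _
  refine ⟨?_, ?_, ?_, ?_, ?_⟩
  · rw [treeLevel_card_succ h2 _ _ _ hne, P.card]; ring
  · rw [treeField_succ, kummer_deg h2 L (fun r => sqrtOf (r - c')) S]
    · rw [P.card, P.deg, ← pow_add]
      congr 1
      have : 0 < 2 ^ n := by positivity
      rw [pow_succ]; omega
    · intro r hr; simp only [hq2]; exact hrL r hr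
    · simpa only [hq2] using hV
  · intro r hr s hs
    rw [mem_treeLevel_succ] at hr hs
    obtain ⟨σ, hσ⟩ := P.trans _ hr _ hs
    have e : (σ r - s) * (σ r - g' + (s - g')) = 0 := by
      simp only [quadMap, map_add, map_pow, map_sub] at hσ
      rw [AlgEquiv.commutes, AlgEquiv.commutes] at hσ
      linear_combination hσ
    rcases mul_eq_zero.mp e with h | h
    · exact ⟨σ, by linear_combination h⟩
    · have hs2 : (s - g') ^ 2 = quadMap g' c' s - c' := by simp [quadMap]
      have hn : s - g' ∉ L := by
        intro hn
        apply hV {quadMap g' c' s} (by simpa using hs) (by simp)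
        rw [Finset.prod_singleton, ← hs2]
        exact ⟨_, hn, rfl⟩
      obtain ⟨τ, hτ, hτs⟩ := exists_sign_swap L (s - g') (by rw [hs2]; exact hrL _ hs) hn
      refine ⟨σ.trans τ, ?_⟩
      have : σ r = g' - (s - g') := by linear_combination h
      rw [AlgEquiv.trans_apply, this, map_sub, hτs, hg', AlgEquiv.commutes]
      ring
  · intro x hx
    rw [treeField_succ] at hx
    obtain ⟨T, hT, hTs⟩ := kummer_sq h2 L (fun r => sqrtOf (r - c')) S
      (by intro r hr; simp only [hq2]; exact hrL r hr) _ (L.algebraMap_mem x) hx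
    simp only [hq2] at hTs
    by_cases hx0 : x = 0
    · exact ⟨∅, by simp, by simp [hx0]⟩
    have hTi : ∀ σ : Ω ≃ₐ[K] Ω, T.image σ = T := by
      intro σ
      by_contra hcon
      have h1 := prod_symmDiff_sq L (fun r => r - c') _ _ _ _ (hsqσ σ T x hTs) hTs
        (fun r hr => hrL r (hT (Finset.mem_inter.mp hr).2))
        (fun r hr => hne r (hT (Finset.mem_inter.mp hr).2))
      refine hV (symmDiff (T.image σ) T) ?_ ?_ ?_
      · intro a ha
        rw [Finset.mem_symmDiff] at ha
        rcases ha with ha | ha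
        · exact hSσ σ T hT ha.1
        · exact hT ha.1
      · rw [Finset.nonempty_iff_ne_empty]
        intro h
        exact hcon (symmDiff_eq_bot.mp h)
      · obtain ⟨y, hy, hy2⟩ := h1
        have hx' : algebraMap K Ω x ≠ 0 := by simpa using hx0
        refine ⟨y / algebraMap K Ω x, L.div_mem hy (L.algebraMap_mem x), ?_⟩
        rw [div_pow, hy2]
        field_simp
    rcases T.eq_empty_or_nonempty with h | h
    · subst h
      obtain ⟨I, hI, h⟩ := P.sq x (by simpa using hTs)
      exact ⟨I, hI.trans (Finset.range_subset_range.mpr (by omega)), h⟩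
    · have := hinv T hT h (fun σ a ha => by
        rw [← hTi σ]; exact Finset.mem_image_of_mem _ ha)
      rw [this, hprod, ← map_mul] at hTs
      obtain ⟨I, hI, h⟩ := P.sq _ hTs
      have hn : n ∉ I := fun h => by simpa using hI h
      refine ⟨insert n I, ?_, ?_⟩
      · intro i hi
        rcases Finset.mem_insert.mp hi with rfl | hi
        · simp
        · have := hI hi
          simp at this ⊢; omega
      · rw [Finset.prod_insert hn, ← mul_assoc]; exact h
  · intro m hm
    rcases Nat.lt_succ_iff_lt_or_eq.mp hm with h | rfl
    · exact P.ne m h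
    · exact hne

lemma treeGood [CharZero K] (g c : K)
    (hyp : ∀ I : Finset ℕ, I.Nonempty → ¬ IsSquare (∏ i ∈ I, dlt g c i)) (n : ℕ) :
    TreeGood K (Ω := Ω) g c n := by
  induction n with
  | zero => exact treeGood_zero g c
  | succ n ih => exact treeGood_succ g c n hyp ih

end Stoll2

section SplitDeg
variable {K : Type*} [Field K]

lemma polyIter_aeval {Ω : Type*} [Field Ω] [Algebra K Ω] (g c : K) (n : ℕ) (x : Ω) :
    aeval x (polyIter ((X - C g) ^ 2 + C c) n)
      = (quadMap (algebraMap K Ω g) (algebraMap K Ω c))^[n] x := by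
  induction n with
  | zero => simp [polyIter]
  | succ n ih => rw [polyIter, aeval_comp, ih, Function.iterate_succ_apply']; simp [quadMap]

lemma polyIter_natDegree (g c : K) (n : ℕ) :
    (polyIter ((X - C g) ^ 2 + C c) n).natDegree = 2 ^ n := by
  induction n with
  | zero => simp [polyIter]
  | succ n ih =>
    rw [polyIter, natDegree_comp, ih, natDegree_add_C, natDegree_pow, natDegree_X_sub_C]; ring

lemma mem_treeLevel {Ω : Type*} [Field Ω] [IsAlgClosed Ω] (g c : Ω) (n : ℕ) : ∀ (x : Ω),
    x ∈ treeLevel g c n ↔ (quadMap g c)^[n] x = 0 := by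
  induction n with
  | zero => intro x; simp [treeLevel]
  | succ n ih => intro x; rw [mem_treeLevel_succ, ih, Function.iterate_succ_apply]

lemma split_deg [CharZero K] (g c : K)
    (hyp : ∀ I : Finset ℕ, I.Nonempty → ¬ IsSquare (∏ i ∈ I, dlt g c i)) (n : ℕ) :
    Module.finrank K (polyIter ((X - C g) ^ 2 + C c) n).SplittingField = 2 ^ (2 ^ n - 1) := by
  set f := polyIter ((X - C g) ^ 2 + C c) n with hf
  let Ω := AlgebraicClosure K
  have h := (treeGood (Ω := Ω) g c hyp n).deg
  have hf0 : f ≠ 0 := by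
    intro h0
    have := polyIter_natDegree g c n
    rw [← hf, h0] at this
    simp at this
    have : 0 < 2 ^ n := by positivity
    omega
  have hroot : f.rootSet Ω = (treeLevel (algebraMap K Ω g) (algebraMap K Ω c) n : Set Ω) := by
    ext x
    rw [mem_rootSet_of_ne hf0, hf, polyIter_aeval, Finset.mem_coe, mem_treeLevel]
  rw [treeField, ← hroot] at h
  have : f.IsSplittingField K (IntermediateField.adjoin K (f.rootSet Ω)) :=
    IntermediateField.adjoin_rootSet_isSplittingField (IsAlgClosed.splits _)
  rw [← h]
  exact (IsSplittingField.algEquiv (IntermediateField.adjoin K (f.rootSet Ω)) f).toLinearEquiv.finrank_eq.symm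
end SplitDeg

section NonSq

lemma isSquare_of_ratFunc (P : ℚ[X]) (h : IsSquare (algebraMap ℚ[X] (RatFunc ℚ) P)) :
    IsSquare P := by
  obtain ⟨y, hy⟩ := h
  have : IsIntegral ℚ[X] y := by
    refine ⟨X ^ 2 - C P, monic_X_pow_sub_C _ two_ne_zero, ?_⟩
    simp [hy, sq]
  obtain ⟨z, rfl⟩ := IsIntegrallyClosed.algebraMap_eq_of_integral this
  refine ⟨z, ?_⟩
  rw [← map_mul] at hy
  exact (IsFractionRing.injective ℚ[X] (RatFunc ℚ)) hy

/-- escape -/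
lemma escape_step (β z : ℂ) (h1 : 2 < ‖z‖) (h2 : ‖β‖ ≤ ‖z‖) : ‖z‖ < ‖z ^ 2 + β‖ := by
  have : ‖z ^ 2‖ ≤ ‖z ^ 2 + β‖ + ‖β‖ := by
    have := norm_sub_le (z ^ 2 + β) β
    simpa using this
  rw [norm_pow] at this
  nlinarith

lemma escape_iter (w : ℕ → ℂ) (β : ℂ) (hw : ∀ k, w (k + 1) = w k ^ 2 + β) (m : ℕ)
    (h1 : 2 < ‖w m‖) (h2 : ‖β‖ ≤ ‖w m‖) (k : ℕ) : ‖w m‖ < ‖w (m + k + 1)‖ := by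
  have : ∀ k, ‖w m‖ ≤ ‖w (m + k)‖ ∧ ‖w (m + k)‖ < ‖w (m + k + 1)‖ := by
    intro k
    induction k with
    | zero => exact ⟨le_rfl, by rw [add_zero, hw]; exact escape_step β _ h1 h2⟩
    | succ k ih =>
      have h3 : ‖w m‖ ≤ ‖w (m + (k + 1))‖ := by rw [← add_assoc]; linarith [ih.1, ih.2]
      refine ⟨h3, ?_⟩
      rw [hw (m + (k + 1))]; exact escape_step β _ (by linarith) (by linarith)
  linarith [(this k).1, (this k).2]

lemma escape_eq (w : ℕ → ℂ) (β : ℂ) (hw0 : w 0 = 0) (hw : ∀ k, w (k + 1) = w k ^ 2 + β) (m n : ℕ)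
    (hm : 1 ≤ m) (hmn : m < n) (e : w m = w n) : ‖β‖ ≤ 2 ∧ ‖w m‖ ≤ 2 := by
  have hw1 : w 1 = β := by rw [hw, hw0]; simp
  have hβ : ‖β‖ ≤ 2 := by
    by_contra hcon
    push Not at hcon
    have hle : ‖β‖ ≤ ‖w m‖ := by
      rcases eq_or_lt_of_le hm with h | h
      · rw [← h, hw1]
      · obtain ⟨k, rfl⟩ : ∃ k, m = 1 + k + 1 := ⟨m - 2, by omega⟩
        have := escape_iter w β hw 1 (by rwa [hw1]) (by rw [hw1]) k
        rw [hw1] at this; exact this.le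
    obtain ⟨k, rfl⟩ : ∃ k, n = m + k + 1 := ⟨n - m - 1, by omega⟩
    have := escape_iter w β hw m (by linarith) hle k
    rw [e] at this; exact lt_irrefl _ this
  refine ⟨hβ, ?_⟩
  by_contra hcon
  push Not at hcon
  obtain ⟨k, rfl⟩ : ∃ k, n = m + k + 1 := ⟨n - m - 1, by omega⟩
  have := escape_iter w β hw m hcon (by linarith) k
  rw [e] at this; exact lt_irrefl _ this

/-- The orbit values are pairwise coprime. -/
lemma orb_coprime (γ c : ℂ[X]) (h1 : ∀ r : ℂ, ‖eval r (c - γ)‖ ≤ 2 → 2 < ‖eval r γ‖) (m n : ℕ)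
    (hm : 1 ≤ m) (hmn : m < n) : IsCoprime (orb γ c n) (orb γ c m) := by
  rw [Polynomial.isCoprime_iff_aeval_ne_zero_of_isAlgClosed ℂ ℂ]
  intro r
  by_contra! hcon
  obtain ⟨hn0, hm0⟩ := hcon
  simp only [coe_aeval_eq_eval] at hn0 hm0
  have := escape_eq (fun k => eval r (orb γ c k) - eval r γ) (eval r (c - γ)) (by simp [orb])
    (by intro k; simp [orb]; ring) m n hm hmn (by simp [hn0, hm0])
  have h2 := h1 r this.1
  have h3 := this.2
  simp only [hm0, zero_sub, norm_neg] at h3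
  linarith

lemma orb_natDegree (γ c : ℂ[X]) (d : ℕ) (hd : 1 ≤ d) (hb : (c - γ).natDegree = d) (n : ℕ) :
    (orb γ c (n + 1) - γ).natDegree = 2 ^ n * d := by
  induction n with
  | zero => simp [orb, hb]
  | succ n ih =>
    have e : orb γ c (n + 1 + 1) - γ = (orb γ c (n + 1) - γ) ^ 2 + (c - γ) := by
      conv_lhs => rw [orb]
      ring
    rw [e, natDegree_add_eq_left_of_natDegree_lt]
    · rw [natDegree_pow, ih]; ring
    · rw [natDegree_pow, ih, hb]
      have : 0 < 2 ^ n := by positivity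
      nlinarith

lemma orb_not_sq (γ c : ℂ[X]) (d : ℕ) (hd : 1 ≤ d) (hb : (c - γ).natDegree = d)
    (hc : c.natDegree ≤ d) (h2 : ∀ e : ℂ, c ≠ C e * (2 * (c - γ) + C e)) (n : ℕ) (h : ℂ[X]) :
    orb γ c (n + 2) ≠ h ^ 2 := by
  intro hh
  set u := orb γ c (n + 1) - γ with hu
  have hud : u.natDegree = 2 ^ n * d := orb_natDegree γ c d hd hb n
  have e : (h - u) * (h + u) = c := by
    rw [orb] at hh
    linear_combination -hh
  have hc0 : c ≠ 0 := by
    intro h0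
    apply h2 0
    simp [h0]
  have ha : h - u ≠ 0 := by intro h0; rw [h0] at e; simp at e; exact hc0 e.symm
  have hb' : h + u ≠ 0 := by intro h0; rw [h0] at e; simp at e; exact hc0 e.symm
  have hsum : (h - u).natDegree + (h + u).natDegree ≤ d := by
    rw [← natDegree_mul ha hb', e]; exact hc
  have hmax : u.natDegree ≤ max (h + u).natDegree (h - u).natDegree := by
    have : (C 2 * u) = (h + u) - (h - u) := by rw [show (C 2 : ℂ[X]) = 2 from rfl]; ring
    rw [← natDegree_C_mul (p := u) (two_ne_zero' ℂ), this]
    exact natDegree_sub_le _ _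
  cases n with
  | succ n =>
    rw [hud] at hmax
    have : 0 < 2 ^ n := by positivity
    have : 2 ^ (n + 1) * d = 2 * (2 ^ n * d) := by ring
    have : 1 ≤ 2 ^ n * d := Nat.mul_pos (by positivity) hd
    have : d ≤ 2 ^ n * d := Nat.le_mul_of_pos_left _ (by positivity)
    rcases le_max_iff.mp hmax with h | h <;> omega
  | zero =>
    have hub : u = c - γ := by simp [hu, orb]
    rw [hud] at hmax
    simp only [pow_zero, one_mul] at hmax
    rcases le_max_iff.mp hmax with h' | h'
    · obtain ⟨x, hx⟩ := natDegree_eq_zero.mp (show (h - u).natDegree = 0 by omega)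
      apply h2 x
      rw [hx, ← hub]
      linear_combination -e
    · obtain ⟨x, hx⟩ := natDegree_eq_zero.mp (show (h + u).natDegree = 0 by omega)
      apply h2 (-x)
      rw [C_neg, hx, ← hub]
      linear_combination -e

lemma sq_of_coprime_mul (P Q h : ℂ[X]) (hc : IsCoprime P Q) (e : P * Q = h ^ 2) :
    ∃ h', P = h' ^ 2 := by
  obtain ⟨a, u, hu⟩ := exists_associated_pow_of_mul_eq_pow' hc e
  obtain ⟨x, hx, hxu⟩ := Polynomial.isUnit_iff.mp u.isUnit
  obtain ⟨y, hy⟩ := IsAlgClosed.exists_pow_nat_eq x (n := 2) two_pos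
  refine ⟨a * C y, ?_⟩
  rw [← hu, ← hxu, ← hy]
  simp [mul_pow]

/-- The genericity conditions. -/
structure GoodPair (d : ℕ) (γ c : ℤ[X]) : Prop where
  degc : c.natDegree ≤ d
  degγ : γ.natDegree ≤ d
  lead : (c - γ).coeff d ≠ 0
  c1 : ∀ r : ℂ, ‖aeval r (c - γ)‖ ≤ 2 → 2 < ‖aeval r γ‖
  c2 : ∀ e : ℂ, c.map (Int.castRingHom ℂ) ≠
    C e * (2 * (c.map (Int.castRingHom ℂ) - γ.map (Int.castRingHom ℂ)) + C e)
  c3 : ¬ IsSquare (-c.coeff 0)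

lemma goodPair_nonsq (d : ℕ) (hd : 1 ≤ d) (γ c : ℤ[X]) (hg : GoodPair d γ c) (I : Finset ℕ)
    (hI : I.Nonempty) : ¬ IsSquare (∏ i ∈ I, dlt
      (algebraMap ℚ[X] (RatFunc ℚ) (γ.map (Int.castRingHom ℚ)))
      (algebraMap ℚ[X] (RatFunc ℚ) (c.map (Int.castRingHom ℚ))) i) := by
  intro hsq
  have e1 : (∏ i ∈ I, dlt (algebraMap ℚ[X] (RatFunc ℚ) (γ.map (Int.castRingHom ℚ)))
      (algebraMap ℚ[X] (RatFunc ℚ) (c.map (Int.castRingHom ℚ))) i)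
      = algebraMap ℚ[X] (RatFunc ℚ)
        (∏ i ∈ I, dlt (γ.map (Int.castRingHom ℚ)) (c.map (Int.castRingHom ℚ)) i) := by
    rw [map_prod]
    exact Finset.prod_congr rfl fun i _ => (dlt_map _ _ _ _).symm
  rw [e1] at hsq
  obtain ⟨h, hh⟩ := isSquare_of_ratFunc _ hsq
  by_cases hI0 : ∀ i ∈ I, i = 0
  · have : I = {0} := by
      obtain ⟨a, ha⟩ := hI
      ext i; simp only [Finset.mem_singleton]
      exact ⟨hI0 i, fun h => by rw [h, ← hI0 a ha]; exact ha⟩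
    rw [this, Finset.prod_singleton, dlt] at hh
    apply hg.c3
    have h2 := congrArg (eval 0) hh
    rw [eval_neg, eval_mul, ← coeff_zero_eq_eval_zero, coeff_map] at h2
    rw [← Rat.isSquare_intCast_iff]
    refine ⟨eval 0 h, ?_⟩
    rw [← h2]; simp
  · push Not at hI0
    obtain ⟨i0, hi0, hi0'⟩ := hI0
    set n := I.max' hI with hn
    have hnI : n ∈ I := I.max'_mem hI
    have hle : ∀ i ∈ I, i ≤ n := fun i hi => I.le_max' i hi
    obtain ⟨k, hk⟩ : ∃ k, n = k + 1 := ⟨n - 1, by have := hle i0 hi0; omega⟩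
    set γ' := γ.map (Int.castRingHom ℂ) with hγ'
    set c' := c.map (Int.castRingHom ℂ) with hc'
    have hh' := congrArg (Polynomial.mapRingHom (algebraMap ℚ ℂ)) hh
    rw [map_prod, map_mul] at hh'
    have e2 : ∀ i, (Polynomial.mapRingHom (algebraMap ℚ ℂ))
        (dlt (γ.map (Int.castRingHom ℚ)) (c.map (Int.castRingHom ℚ)) i) = dlt γ' c' i := by
      intro i
      rw [dlt_map]
      simp only [coe_mapRingHom, Polynomial.map_map, hγ', hc']
      congr 2
    simp only [e2] at hh'
    rw [← Finset.mul_prod_erase I _ hnI, ← sq] at hh'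
    have hcop : IsCoprime (dlt γ' c' n) (∏ i ∈ I.erase n, dlt γ' c' i) := by
      apply IsCoprime.prod_right
      intro i hi
      rw [Finset.mem_erase] at hi
      have hi' := hle i hi.2
      have key := orb_coprime γ' c' (by
        intro r hr
        have := hg.c1 r
        simp only [aeval_def, ← eval_map] at this
        rw [Polynomial.map_sub] at this
        exact this hr) (i + 1) (n + 1) (by omega) (by omega)
      cases i with
      | zero =>
        rw [hk] at key ⊢
        change IsCoprime (orb γ' c' (k + 2)) (-c')
        rw [IsCoprime.neg_right_iff]
        have e3 : orb γ' c' (0 + 1) = c' := by simp [orb]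
        rw [e3] at key
        exact key
      | succ i => rw [hk] at key ⊢; exact key
    obtain ⟨h', hh''⟩ := sq_of_coprime_mul _ _ _ hcop hh'
    rw [hk, dlt] at hh''
    have hdc : c'.natDegree ≤ d := natDegree_map_le.trans hg.degc
    have hdγ : γ'.natDegree ≤ d := natDegree_map_le.trans hg.degγ
    refine orb_not_sq γ' c' d hd ?_ hdc hg.c2 k h' hh''
    apply le_antisymm
    · exact (natDegree_sub_le _ _).trans (max_le hdc hdγ)
    · apply le_natDegree_of_ne_zero
      rw [hc', hγ', ← Polynomial.map_sub, coeff_map]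
      intro h
      exact hg.lead (Int.cast_injective (α := ℂ) (by simpa using h))
end NonSq

section Count

lemma count_int (s : Finset ℤ) (x D : ℝ) (hD : 0 ≤ D) (h : ∀ k ∈ s, |(k : ℝ) - x| ≤ D) :
    (s.card : ℝ) ≤ 2 * D + 1 := by
  have hsub : s ⊆ Finset.Icc ⌈x - D⌉ ⌊x + D⌋ := by
    intro k hk
    have := abs_le.mp (h k hk)
    rw [Finset.mem_Icc, Int.ceil_le, Int.le_floor]
    constructor <;> linarith
  have h1 := Finset.card_le_card hsub
  rw [Int.card_Icc] at h1
  have h2 : ((⌊x + D⌋ + 1 - ⌈x - D⌉).toNat : ℝ) ≤ 2 * D + 1 := by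
    have h3 : (⌊x + D⌋ : ℝ) ≤ x + D := Int.floor_le _
    have h4 : x - D ≤ (⌈x - D⌉ : ℝ) := Int.le_ceil _
    have h5 : (((⌊x + D⌋ + 1 - ⌈x - D⌉).toNat : ℤ) : ℝ) ≤ 2 * D + 1 := by
      rw [Int.toNat_eq_max, Int.cast_max]
      apply max_le
      · push_cast; linarith
      · push_cast; linarith
    exact_mod_cast h5
  calc (s.card : ℝ) ≤ _ := by exact_mod_cast h1
    _ ≤ _ := h2

/-- Integer polynomials in the box. -/
noncomputable def boxF (d B : ℕ) : Finset ℤ[X] :=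
  (Fintype.piFinset fun _ : Fin (d + 1) => Finset.Icc (-(B : ℤ)) B).map
    ⟨fun a => ofFn (d + 1) a, injective_ofFn (d + 1)⟩

lemma mem_boxF (d B : ℕ) (f : ℤ[X]) :
    f ∈ boxF d B ↔ f.natDegree ≤ d ∧ ∀ i, |f.coeff i| ≤ (B : ℤ) := by
  simp only [boxF, Finset.mem_map, Fintype.mem_piFinset, Finset.mem_Icc,
    Function.Embedding.coeFn_mk]
  constructor
  · rintro ⟨a, ha, rfl⟩
    refine ⟨Nat.lt_succ_iff.mp (ofFn_natDegree_lt (by omega) a), fun i => ?_⟩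
    by_cases hi : i < d + 1
    · rw [ofFn_coeff_eq_val_of_lt _ hi]
      exact abs_le.mpr (ha _)
    · rw [ofFn_coeff_eq_zero_of_ge a (Nat.le_of_not_lt hi)]; simp
  · rintro ⟨h1, h2⟩
    refine ⟨toFn (d + 1) f, fun i => abs_le.mp (by simpa [toFn] using h2 i), ?_⟩
    exact ofFn_comp_toFn_eq_id_of_natDegree_lt (by omega)

lemma card_boxF (d B : ℕ) : (boxF d B).card = (2 * B + 1) ^ (d + 1) := by
  rw [boxF, Finset.card_map, Fintype.card_piFinset]
  simp
  omega

lemma fiber_bound {α β : Type*} [DecidableEq β] (s : Finset α) (t : Finset β) (f : α → β)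
    (hf : ∀ a ∈ s, f a ∈ t) (g : ℝ)
    (h : ∀ b ∈ t, ((s.filter fun a => f a = b).card : ℝ) ≤ g) : (s.card : ℝ) ≤ g * t.card := by
  rw [Finset.card_eq_sum_card_fiberwise hf]
  push_cast
  calc _ ≤ ∑ b ∈ t, g := Finset.sum_le_sum h
    _ = _ := by rw [Finset.sum_const, nsmul_eq_mul]; ring

/-- few pairs have a small leading coefficient difference -/
lemma count_small_lead (d B M : ℕ) (hd : 1 ≤ d) (hM : 1 ≤ M) (s : Finset (ℤ[X] × ℤ[X]))
    (hs : s ⊆ boxF d B ×ˢ boxF d B)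
    (h : ∀ p ∈ s, |(p.2 - p.1).coeff d| * (M : ℤ) < B) :
    (s.card : ℝ) ≤ (2 * (B / M) + 1) * (2 * B + 1) ^ (2 * d + 1) := by
  classical
  have hf : ∀ p ∈ s, (p.1, p.2.erase d) ∈ boxF d B ×ˢ boxF (d - 1) B := by
    intro p hp
    have := Finset.mem_product.mp (hs hp)
    rw [mem_boxF, mem_boxF] at this
    obtain ⟨h1, h2, h3⟩ := this
    rw [Finset.mem_product, mem_boxF, mem_boxF]
    refine ⟨h1, ?_, ?_⟩
    · rw [natDegree_le_iff_coeff_eq_zero]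
      intro N hN
      rw [coeff_erase]
      split_ifs with hNd
      · rfl
      · exact coeff_eq_zero_of_natDegree_lt (by omega)
    · intro i
      rw [coeff_erase]
      split_ifs
      · simp
      · exact h3 i
  have := fiber_bound s _ _ hf (2 * (B / M) + 1) ?_
  · refine this.trans (le_of_eq ?_)
    rw [Finset.card_product, card_boxF, card_boxF, Nat.sub_add_cancel hd, ← pow_add]
    push_cast
    congr 2
    omega
  · rintro ⟨g, q⟩ _
    rw [← Finset.card_image_of_injOn (f := fun p : ℤ[X] × ℤ[X] => p.2.coeff d)]
    · apply count_int _ (g.coeff d : ℝ) _ (by positivity)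
      intro k hk
      obtain ⟨p, hp, rfl⟩ := Finset.mem_image.mp hk
      obtain ⟨hp, hpe⟩ := Finset.mem_filter.mp hp
      have h1 := h p hp
      have h2 : p.1 = g := congrArg Prod.fst hpe
      rw [h2, coeff_sub] at h1
      rw [le_div_iff₀ (by exact_mod_cast hM)]
      have : ((|p.2.coeff d - g.coeff d| * (M : ℤ) : ℤ) : ℝ) < ((B : ℤ) : ℝ) := by
        exact_mod_cast h1
      push_cast at this
      exact this.le
    · intro p hp p' hp' e
      have h1 := (Finset.mem_filter.mp hp).2
      have h2 := (Finset.mem_filter.mp hp').2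
      rw [← h2] at h1
      simp only [Prod.mk.injEq] at h1
      refine Prod.ext h1.1 ?_
      ext i
      by_cases hi : i = d
      · rw [hi]; exact e
      · have := congrArg (fun f => f.coeff i) h1.2
        simpa [coeff_erase, hi] using this
end Count

section Roots

lemma pow_sub_bound (R : ℝ) (hR : 1 ≤ R) (x y : ℂ) (hx : ‖x‖ ≤ R) (hy : ‖y‖ ≤ R) (j : ℕ) :
    ‖x ^ j - y ^ j‖ ≤ j * R ^ j * ‖x - y‖ := by
  induction j with
  | zero => simp
  | succ j ih =>
    have e : x ^ (j + 1) - y ^ (j + 1) = x * (x ^ j - y ^ j) + (x - y) * y ^ j := by ring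
    have h1 : ‖x * (x ^ j - y ^ j)‖ ≤ R * (j * R ^ j * ‖x - y‖) := by
      rw [norm_mul]; gcongr
    have h2 : ‖(x - y) * y ^ j‖ ≤ ‖x - y‖ * R ^ (j + 1) := by
      rw [norm_mul, norm_pow]
      gcongr
      calc ‖y‖ ^ j ≤ R ^ j := by gcongr
        _ ≤ R ^ (j + 1) := pow_le_pow_right₀ hR (by omega)
    rw [e]
    calc _ ≤ _ := norm_add_le _ _
      _ ≤ R * (j * R ^ j * ‖x - y‖) + ‖x - y‖ * R ^ (j + 1) := add_le_add h1 h2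
      _ = _ := by push_cast; ring

lemma poly_lip (d : ℕ) (B R : ℝ) (hR : 1 ≤ R) (f : ℂ[X]) (hf : f.natDegree ≤ d)
    (hB : ∀ i, ‖f.coeff i‖ ≤ B) (x y : ℂ) (hx : ‖x‖ ≤ R) (hy : ‖y‖ ≤ R) :
    ‖eval x f - eval y f‖ ≤ (∑ j ∈ Finset.range (d + 1), (j : ℝ) * R ^ j) * B * ‖x - y‖ := by
  have hB0 : 0 ≤ B := (norm_nonneg _).trans (hB 0)
  rw [eval_eq_sum_range' (n := d + 1) (by omega), eval_eq_sum_range' (n := d + 1) (by omega),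
    ← Finset.sum_sub_distrib, Finset.sum_mul, Finset.sum_mul]
  refine (norm_sum_le _ _).trans (Finset.sum_le_sum fun j _ => ?_)
  rw [← mul_sub, norm_mul]
  calc ‖f.coeff j‖ * ‖x ^ j - y ^ j‖ ≤ B * (j * R ^ j * ‖x - y‖) := by
        gcongr
        · exact hB j
        · exact pow_sub_bound R hR x y hx hy j
    _ = _ := by ring

lemma multiset_prod_lower (s : Multiset ℂ) (r : ℂ) (η : ℝ) (hη : 0 ≤ η)
    (h : ∀ β ∈ s, η ≤ ‖r - β‖) : η ^ s.card ≤ ‖(s.map fun β => r - β).prod‖ := by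
  induction s using Multiset.induction_on with
  | empty => simp
  | cons a s ih =>
    simp only [Multiset.card_cons, Multiset.map_cons, Multiset.prod_cons, norm_mul]
    rw [pow_succ, mul_comm]
    have h1 := h a (by simp)
    have h2 := ih fun β hβ => h β (by simp [hβ])
    gcongr

lemma exists_near_root (d : ℕ) (b : ℂ[X]) (hb : b.natDegree = d) (hb0 : b ≠ 0) (η : ℝ)
    (hη : 0 < η) (r : ℂ) (hr : ‖eval r b‖ < ‖b.leadingCoeff‖ * η ^ d) :
    ∃ β ∈ b.roots, ‖r - β‖ < η := by
  by_contra! hcon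
  have hs : b.Splits := IsAlgClosed.splits b
  have h1 := multiset_prod_lower b.roots r η hη.le hcon
  have hcard : b.roots.card = d := by rw [← hb]; exact hs.natDegree_eq_card_roots.symm
  have he : eval r b = b.leadingCoeff * (b.roots.map fun β => r - β).prod := by
    exact hs.eval_eq_prod_roots r
  rw [he, norm_mul] at hr
  have hl : 0 < ‖b.leadingCoeff‖ := by simpa using hb0
  have := lt_of_mul_lt_mul_left hr hl.le
  rw [hcard] at h1
  linarith

lemma root_bound (d : ℕ) (b : ℂ[X]) (hb : b.natDegree = d) (hb0 : b ≠ 0) (B M : ℝ)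
    (hB : 0 < B) (hM : 0 < M) (h1 : ∀ i, ‖b.coeff i‖ ≤ 2 * B) (h2 : B ≤ ‖b.leadingCoeff‖ * M)
    (β : ℂ) (hβ : β ∈ b.roots) : ‖β‖ ≤ 2 * M + 1 := by
  have h3 := Polynomial.IsRoot.norm_lt_cauchyBound hb0 ((mem_roots hb0).mp hβ)
  have hl : 0 < ‖b.leadingCoeff‖ := by simpa using hb0
  have h4 : ‖β‖ < (cauchyBound b : ℝ) := by exact_mod_cast h3
  refine h4.le.trans ?_
  rw [cauchyBound]
  push_cast
  gcongr
  rw [div_le_iff₀ hl]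
  have h5 : (Finset.range b.natDegree).sup (fun i => ‖b.coeff i‖₊) ≤ (2 * B).toNNReal := by
    apply Finset.sup_le
    intro i _
    rw [← NNReal.coe_le_coe, Real.coe_toNNReal _ (by positivity)]
    exact h1 i
  have h6 : (((Finset.range b.natDegree).sup (fun i => ‖b.coeff i‖₊) : NNReal) : ℝ) ≤ 2 * B := by
    rw [← NNReal.coe_le_coe, Real.coe_toNNReal _ (by positivity)] at h5
    exact h5
  refine h6.trans ?_
  nlinarith
end Roots

section Fiber

/-- Constant in the Lipschitz estimate. -/
noncomputable def lipC (d M : ℕ) : ℝ :=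
  ∑ j ∈ Finset.range (d + 1), (j : ℝ) * (2 * (M : ℝ) + 2) ^ j

lemma lipC_nonneg (d M : ℕ) : 0 ≤ lipC d M := by
  unfold lipC; positivity

lemma count_c1 (d B M : ℕ) (hB : 1 ≤ B) (hM : 1 ≤ M) (η : ℝ) (hη : 0 < η)
    (hη1 : η ≤ 1) (hBM : 2 * (M : ℝ) < B * η ^ d) (b f : ℤ[X]) (hb : b ∈ boxF d (2 * B))
    (hf : f ∈ boxF d B) (hlead : (B : ℤ) ≤ |b.coeff d| * M) (s : Finset ℤ)
    (hs : ∀ k ∈ s, ∃ r : ℂ, ‖aeval r b‖ ≤ 2 ∧ ‖aeval r (f + C k)‖ ≤ 2) :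
    (s.card : ℝ) ≤ d * (2 * (lipC d M * B * η + 2) + 1) := by
  classical
  rw [mem_boxF] at hb hf
  have hM' : (1 : ℝ) ≤ M := by exact_mod_cast hM
  have hB' : (1 : ℝ) ≤ B := by exact_mod_cast hB
  set b' := b.map (Int.castRingHom ℂ) with hb'
  set f' := f.map (Int.castRingHom ℂ) with hf'
  have hbd : b.coeff d ≠ 0 := by
    intro h
    rw [h] at hlead
    simp at hlead
    omega
  have hbd' : b'.coeff d ≠ 0 := by
    rw [hb', coeff_map]
    simpa using hbd
  have hdeg : b'.natDegree = d :=
    le_antisymm (natDegree_map_le.trans hb.1) (le_natDegree_of_ne_zero hbd')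
  have hb0 : b' ≠ 0 := by
    intro h
    rw [h] at hbd'
    simp at hbd'
  have hnorm : ∀ (g : ℤ[X]) (i : ℕ),
      ‖(g.map (Int.castRingHom ℂ)).coeff i‖ = ((|g.coeff i| : ℤ) : ℝ) := by
    intro g i
    rw [coeff_map]
    simp
  have hlc : (B : ℝ) ≤ ‖b'.leadingCoeff‖ * M := by
    rw [leadingCoeff, hdeg, hnorm]
    exact_mod_cast hlead
  have hcard : (b'.roots.toFinset.card : ℝ) ≤ d := by
    have h1 := (Multiset.toFinset_card_le b'.roots).trans (card_roots' b')
    rw [hdeg] at h1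
    exact_mod_cast h1
  set D := lipC d M * B * η + 2 with hD
  have hD0 : 0 ≤ D := by
    have := lipC_nonneg d M
    positivity
  have hsub : s ⊆ b'.roots.toFinset.biUnion fun β =>
      s.filter fun k : ℤ => |(k : ℝ) - (-(eval β f').re)| ≤ D := by
    intro k hk
    obtain ⟨r, hr1, hr2⟩ := hs k hk
    rw [aeval_def, ← eval_map] at hr1 hr2
    have hr1' : ‖eval r b'‖ < ‖b'.leadingCoeff‖ * η ^ d := by
      refine lt_of_le_of_lt hr1 ?_
      have hηd : 0 < η ^ d := by positivity
      have : 2 * (M : ℝ) < (‖b'.leadingCoeff‖ * η ^ d) * M := by nlinarith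
      exact lt_of_mul_lt_mul_right this (by positivity)
    obtain ⟨β, hβ, hβr⟩ := exists_near_root d b' hdeg hb0 η hη r hr1'
    have hβR := root_bound d b' hdeg hb0 B M (by linarith) (by linarith) (by
      intro i
      rw [hnorm]
      have := hb.2 i
      exact_mod_cast this) hlc β hβ
    have hrR : ‖r‖ ≤ 2 * (M : ℝ) + 2 := by
      have := norm_add_le (r - β) β
      rw [sub_add_cancel] at this
      linarith
    have hlip := poly_lip d B (2 * (M : ℝ) + 2) (by linarith) f' (natDegree_map_le.trans hf.1)
      (by
        intro i
        rw [hnorm]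
        have := hf.2 i
        exact_mod_cast this) β r (by linarith) hrR
    rw [Finset.mem_biUnion]
    refine ⟨β, by simpa using hβ, Finset.mem_filter.mpr ⟨hk, ?_⟩⟩
    have e : ((k : ℝ) - (-(eval β f').re)) = ((k : ℂ) + eval β f').re := by simp
    rw [e]
    refine (Complex.abs_re_le_norm _).trans ?_
    have e2 : (k : ℂ) + eval β f' = (eval β f' - eval r f') + (eval r f' + k) := by ring
    rw [e2]
    refine (norm_add_le _ _).trans ?_
    have h3 : ‖eval r f' + k‖ ≤ 2 := by
      convert hr2 using 2
      simp [hf']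
    have h4 : (lipC d M * B) * ‖β - r‖ ≤ (lipC d M * B) * η := by
      have := lipC_nonneg d M
      rw [norm_sub_rev]
      gcongr
    have h5 : ‖eval β f' - eval r f'‖ ≤ lipC d M * B * ‖β - r‖ := hlip
    rw [hD]
    linarith
  have h1 := (Finset.card_le_card hsub).trans Finset.card_biUnion_le
  calc (s.card : ℝ) ≤ ((∑ β ∈ b'.roots.toFinset,
        (s.filter fun k : ℤ => |(k : ℝ) - (-(eval β f').re)| ≤ D).card : ℕ) : ℝ) := by
          exact_mod_cast h1
    _ ≤ ∑ β ∈ b'.roots.toFinset, (2 * D + 1) := by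
      push_cast
      refine Finset.sum_le_sum fun β _ => ?_
      exact count_int _ _ D hD0 fun k hk => (Finset.mem_filter.mp hk).2
    _ = b'.roots.toFinset.card * (2 * D + 1) := by rw [Finset.sum_const, nsmul_eq_mul]
    _ ≤ _ := by gcongr

lemma count_c2 (d : ℕ) (hd : 1 ≤ d) (b f : ℤ[X]) (hb : b.coeff d ≠ 0) (s : Finset ℤ)
    (hs : ∀ k ∈ s, ∃ e : ℂ, (b + f + C k).map (Int.castRingHom ℂ) =
      C e * (2 * b.map (Int.castRingHom ℂ) + C e)) : s.card ≤ 1 := by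
  rw [Finset.card_le_one]
  intro k hk k' hk'
  obtain ⟨e, he⟩ := hs k hk
  obtain ⟨e', he'⟩ := hs k' hk'
  have hco : ∀ (k : ℤ) (e : ℂ), (b + f + C k).map (Int.castRingHom ℂ) =
      C e * (2 * b.map (Int.castRingHom ℂ) + C e) →
      (b.coeff d + f.coeff d : ℂ) = 2 * e * b.coeff d := by
    intro k e h
    have h1 := congrArg (fun p => coeff p d) h
    have h2 : (2 : ℂ[X]) = C 2 := rfl
    simp only [coeff_map, coeff_add, coeff_C_mul, coeff_C, h2, if_neg (show d ≠ 0 by omega),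
      Int.coe_castRingHom, Int.cast_add, add_zero] at h1
    rw [h1]; ring
  have h1 := hco k e he
  have h2 := hco k' e' he'
  have hb' : (b.coeff d : ℂ) ≠ 0 := by exact_mod_cast hb
  have hee : e = e' := by
    have : (2 * (b.coeff d : ℂ)) * (e - e') = 0 := by linear_combination h2 - h1
    have := (mul_eq_zero.mp this).resolve_left (by simpa using hb')
    linear_combination this
  rw [hee, ← he'] at he
  have h3 := congrArg (fun p => coeff p 0) he
  simp at h3
  exact h3

lemma count_c3 (B : ℕ) (b0 : ℤ) (s : Finset ℤ)
    (hs : ∀ k ∈ s, |b0 + k| ≤ (B : ℤ) ∧ IsSquare (-(b0 + k))) : s.card ≤ Nat.sqrt B + 1 := by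
  have : s ⊆ (Finset.range (Nat.sqrt B + 1)).image fun m : ℕ => -(m : ℤ) ^ 2 - b0 := by
    intro k hk
    obtain ⟨h1, m, hm⟩ := hs k hk
    rw [Finset.mem_image]
    refine ⟨m.natAbs, ?_, ?_⟩
    · rw [Finset.mem_range, Nat.lt_succ_iff, Nat.le_sqrt]
      have : m * m ≤ B := by rw [← hm]; exact (neg_le_abs _).trans h1
      zify
      rw [← abs_mul, abs_mul_self]; exact this
    · simp only [Int.natCast_natAbs, sq_abs]
      linear_combination hm
  refine (Finset.card_le_card this).trans (Finset.card_image_le.trans ?_)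
  simp

lemma count_fiber (d B M : ℕ) (hd : 1 ≤ d) (hB : 1 ≤ B) (hM : 1 ≤ M) (η : ℝ) (hη : 0 < η)
    (hη1 : η ≤ 1) (hBM : 2 * (M : ℝ) < B * η ^ d) (b f : ℤ[X]) (hb : b ∈ boxF d (2 * B))
    (hf : f ∈ boxF d B) (hf0 : f.coeff 0 = 0) (hlead : (B : ℤ) ≤ |b.coeff d| * M) (s : Finset ℤ)
    (hs : ∀ k ∈ s, |b.coeff 0 + k| ≤ (B : ℤ) ∧ ¬ GoodPair d (f + C k) (b + f + C k)) :
    (s.card : ℝ) ≤ d * (2 * (lipC d M * B * η + 2) + 1) + 1 + (Nat.sqrt B + 1) := by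
  classical
  have hbd : b.coeff d ≠ 0 := by
    intro h
    rw [h] at hlead
    simp at hlead
    omega
  set s1 := s.filter fun k => ∃ r : ℂ, ‖aeval r b‖ ≤ 2 ∧ ‖aeval r (f + C k)‖ ≤ 2
  set s2 := s.filter fun k => ∃ e : ℂ, (b + f + C k).map (Int.castRingHom ℂ) =
      C e * (2 * b.map (Int.castRingHom ℂ) + C e)
  set s3 := s.filter fun k => IsSquare (-(b.coeff 0 + k))
  have hsub : s ⊆ s1 ∪ s2 ∪ s3 := by
    intro k hk
    by_contra hcon
    simp only [Finset.mem_union, not_or, s1, s2, s3, Finset.mem_filter, hk, true_and,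
      not_exists] at hcon
    obtain ⟨⟨h1, h2⟩, h3⟩ := hcon
    apply (hs k hk).2
    rw [mem_boxF] at hb hf
    have e : b + f + C k - (f + C k) = b := by ring
    have hd1 : (f + C k).natDegree ≤ d := by rw [natDegree_add_C]; exact hf.1
    refine ⟨?_, hd1, by rwa [e], ?_, ?_, ?_⟩
    · rw [add_assoc]; exact (natDegree_add_le _ _).trans (max_le hb.1 hd1)
    · intro r hr
      rw [e] at hr
      by_contra hh
      exact h1 r ⟨hr, not_lt.mp hh⟩
    · intro x
      rw [← Polynomial.map_sub, e]
      exact h2 x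
    · simpa [hf0] using h3
  have c1 := count_c1 d B M hB hM η hη hη1 hBM b f hb hf hlead s1
    (fun k hk => (Finset.mem_filter.mp hk).2)
  have c2 := count_c2 d hd b f hbd s2 (fun k hk => (Finset.mem_filter.mp hk).2)
  have c3 := count_c3 B (b.coeff 0) s3 (fun k hk => ⟨(hs k (Finset.mem_filter.mp hk).1).1,
    (Finset.mem_filter.mp hk).2⟩)
  have h4 : s.card ≤ s1.card + s2.card + s3.card :=
    (Finset.card_le_card hsub).trans ((Finset.card_union_le _ _).trans
      (Nat.add_le_add_right (Finset.card_union_le _ _) _))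
  have h4' : (s.card : ℝ) ≤ s1.card + s2.card + s3.card := by exact_mod_cast h4
  have c2' : (s2.card : ℝ) ≤ 1 := by exact_mod_cast c2
  have c3' : (s3.card : ℝ) ≤ Nat.sqrt B + 1 := by exact_mod_cast c3
  linarith

lemma count_bad (d B M : ℕ) (hd : 1 ≤ d) (hB : 1 ≤ B) (hM : 1 ≤ M) (η : ℝ) (hη : 0 < η)
    (hη1 : η ≤ 1) (hBM : 2 * (M : ℝ) < B * η ^ d) (s : Finset (ℤ[X] × ℤ[X]))
    (hs : s ⊆ boxF d B ×ˢ boxF d B) (hbad : ∀ p ∈ s, ¬ GoodPair d p.1 p.2)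
    (h : ∀ p ∈ s, (B : ℤ) ≤ |(p.2 - p.1).coeff d| * (M : ℤ)) :
    (s.card : ℝ) ≤ (d * (2 * (lipC d M * B * η + 2) + 1) + 1 + (Nat.sqrt B + 1)) *
      ((2 * B + 1) ^ d * (4 * B + 1) ^ (d + 1)) := by
  classical
  have hf : ∀ p ∈ s, (p.1 - C (p.1.coeff 0), p.2 - p.1) ∈
      ((boxF d B).filter fun f => f.coeff 0 = 0) ×ˢ boxF d (2 * B) := by
    intro p hp
    have := Finset.mem_product.mp (hs hp)
    rw [mem_boxF, mem_boxF] at this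
    obtain ⟨⟨h1, h2⟩, h3, h4⟩ := this
    rw [Finset.mem_product, Finset.mem_filter, mem_boxF, mem_boxF]
    refine ⟨⟨⟨?_, ?_⟩, by simp⟩, ?_, ?_⟩
    · rw [natDegree_sub_C]; exact h1
    · intro i
      rw [coeff_sub, coeff_C]
      split_ifs with hi
      · simp [hi]
      · simpa using h2 i
    · exact (natDegree_sub_le _ _).trans (max_le h3 h1)
    · intro i
      rw [coeff_sub]
      have := abs_sub (p.2.coeff i) (p.1.coeff i)
      have h5 := h2 i
      have h6 := h4 i
      push_cast
      omega
  have hcard : ((boxF d B).filter fun f => f.coeff 0 = 0).card ≤ (2 * B + 1) ^ d := by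
    have h1 : ((boxF d B).filter fun f => f.coeff 0 = 0).card ≤ (boxF (d - 1) B).card := by
      apply Finset.card_le_card_of_injOn (fun f => f.divX)
      · intro f hf
        obtain ⟨hf, -⟩ := Finset.mem_filter.mp hf
        rw [mem_boxF] at hf
        rw [Finset.mem_coe, mem_boxF]
        refine ⟨?_, fun i => ?_⟩
        · rw [natDegree_divX_eq_natDegree_tsub_one]; omega
        · rw [coeff_divX]; exact hf.2 _
      · intro f hf f' hf' e
        have h1 := (Finset.mem_filter.mp hf).2
        have h2 := (Finset.mem_filter.mp hf').2
        have e' : f.divX = f'.divX := e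
        rw [← divX_mul_X_add f, ← divX_mul_X_add f', e', h1, h2]
    rwa [card_boxF, Nat.sub_add_cancel hd] at h1
  set G : ℝ := (d * (2 * (lipC d M * B * η + 2) + 1) + 1 + (Nat.sqrt B + 1)) with hG
  have hG0 : 0 ≤ G := by
    have := lipC_nonneg d M
    positivity
  have := fiber_bound s _ _ hf G ?_
  · refine this.trans ?_
    rw [Finset.card_product, card_boxF]
    push_cast
    rw [show (2 * (2 * (B : ℝ)) + 1) = 4 * B + 1 by ring]
    gcongr
    exact_mod_cast hcard
  · rintro ⟨f, b⟩ hfb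
    obtain ⟨hf1, hb1⟩ := Finset.mem_product.mp hfb
    obtain ⟨hf1, hf2⟩ := Finset.mem_filter.mp hf1
    have key : ∀ p ∈ s.filter (fun p => (p.1 - C (p.1.coeff 0), p.2 - p.1) = (f, b)),
        p ∈ s ∧ p.1 = f + C (p.1.coeff 0) ∧ p.2 = b + f + C (p.1.coeff 0) := by
      intro p hp
      obtain ⟨hp, e⟩ := Finset.mem_filter.mp hp
      rw [Prod.mk.injEq] at e
      refine ⟨hp, ?_, ?_⟩
      · rw [← e.1]; ring
      · rw [← e.1, ← e.2]; ring
    by_cases hlead : (B : ℤ) ≤ |b.coeff d| * M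
    · rw [← Finset.card_image_of_injOn (f := fun p : ℤ[X] × ℤ[X] => p.1.coeff 0)]
      · apply count_fiber d B M hd hB hM η hη hη1 hBM b f hb1 hf1 hf2 hlead
        intro k hk
        obtain ⟨p, hp, rfl⟩ := Finset.mem_image.mp hk
        obtain ⟨h1, h2, h3⟩ := key p hp
        have hbox := (mem_boxF _ _ _).mp (Finset.mem_product.mp (hs h1)).2
        refine ⟨?_, ?_⟩
        · have h4 := hbox.2 0
          rw [h3] at h4
          simpa [hf2] using h4
        · have h5 := hbad p h1
          rw [h3] at h5
          rw [h2] at h5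
          simpa [hf2] using h5
      · intro p hp p' hp' e
        obtain ⟨h1, h2, h3⟩ := key p hp
        obtain ⟨h1', h2', h3'⟩ := key p' hp'
        have e' : p.1.coeff 0 = p'.1.coeff 0 := e
        refine Prod.ext ?_ ?_
        · rw [h2, h2', e']
        · rw [h3, h3', e']
    · have : s.filter (fun p => (p.1 - C (p.1.coeff 0), p.2 - p.1) = (f, b)) = ∅ := by
        rw [Finset.filter_eq_empty_iff]
        intro p hp e
        rw [Prod.mk.injEq] at e
        apply hlead
        rw [← e.2]
        exact h p hp
      rw [this]
      simpa using hG0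
end Fiber

section Final

lemma surj_of_good (d : ℕ) (hd : 1 ≤ d) (γ c : ℤ[X]) (h : GoodPair d γ c) : IsSurjPair γ c :=
  fun n _ => split_deg _ _ (goodPair_nonsq d hd γ c h) n

open Classical in
/-- Bad pairs in the box. -/
noncomputable def badSet (d B : ℕ) : Finset (ℤ[X] × ℤ[X]) :=
  (boxF d B ×ˢ boxF d B).filter fun p => ¬ GoodPair d p.1 p.2

lemma surSet_card (d B : ℕ) (hd : 1 ≤ d) :
    Nat.card (SurSet d B) ≤ (2 * B + 1) ^ (2 * d + 2) ∧
    (2 * B + 1) ^ (2 * d + 2) ≤ Nat.card (SurSet d B) + (badSet d B).card := by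
  classical
  have hbox : (boxF d B ×ˢ boxF d B).card = (2 * B + 1) ^ (2 * d + 2) := by
    rw [Finset.card_product, card_boxF, ← pow_add]; congr 1; omega
  have hsub : SurSet d B ⊆ ((boxF d B ×ˢ boxF d B : Finset _) : Set (ℤ[X] × ℤ[X])) := by
    intro p hp
    obtain ⟨h1, h2, h3, h4, _⟩ := hp
    rw [Finset.mem_coe, Finset.mem_product, mem_boxF, mem_boxF]
    exact ⟨⟨h1, h3⟩, h2, h4⟩
  have hfin : (SurSet d B).Finite := (Finset.finite_toSet _).subset hsub
  rw [← hbox, Nat.card_coe_set_eq]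
  constructor
  · rw [← Set.ncard_coe_finset]
    exact Set.ncard_le_ncard hsub (Finset.finite_toSet _)
  · rw [← Finset.card_filter_add_card_filter_not (s := boxF d B ×ˢ boxF d B)
      (fun p => GoodPair d p.1 p.2)]
    refine Nat.add_le_add ?_ (le_of_eq rfl)
    rw [← Set.ncard_coe_finset]
    refine Set.ncard_le_ncard ?_ hfin
    intro p hp
    obtain ⟨hp, hg⟩ := Finset.mem_filter.mp hp
    rw [Finset.mem_product, mem_boxF, mem_boxF] at hp
    exact ⟨hp.1.1, hp.2.1, hp.1.2, hp.2.2, surj_of_good d hd _ _ hg⟩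

lemma bad_ratio (d B M : ℕ) (hd : 1 ≤ d) (hB : 1 ≤ B) (hM : 1 ≤ M) (η : ℝ) (hη : 0 < η)
    (hη1 : η ≤ 1) (hBM : 2 * (M : ℝ) < B * η ^ d) :
    ((badSet d B).card : ℝ) / (2 * (B : ℝ) + 1) ^ (2 * d + 2) ≤
      1 / M + 2 ^ (d + 1) * (d * lipC d M * η) +
      ((1 + 2 ^ (d + 1) * (5 * d + 2)) / (2 * B + 1)
        + 2 ^ (d + 1) * (√(B : ℝ) / (2 * B + 1))) := by
  classical
  set s1 := (badSet d B).filter fun p => |(p.2 - p.1).coeff d| * (M : ℤ) < B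
  set s2 := (badSet d B).filter fun p => ¬ |(p.2 - p.1).coeff d| * (M : ℤ) < B
  have hsplit : (badSet d B).card = s1.card + s2.card :=
    (Finset.card_filter_add_card_filter_not _).symm
  have hbadsub : badSet d B ⊆ boxF d B ×ˢ boxF d B := Finset.filter_subset _ _
  have h1 := count_small_lead d B M hd hM s1 ((Finset.filter_subset _ _).trans hbadsub)
    (fun p hp => (Finset.mem_filter.mp hp).2)
  have h2 := count_bad d B M hd hB hM η hη hη1 hBM s2 ((Finset.filter_subset _ _).trans hbadsub)
    (fun p hp => (Finset.mem_filter.mp (Finset.mem_filter.mp hp).1).2)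
    (fun p hp => not_lt.mp (Finset.mem_filter.mp hp).2)
  have hM0 : (0 : ℝ) < M := by exact_mod_cast hM
  set x : ℝ := 2 * (B : ℝ) + 1 with hx
  have hx0 : 0 < x := by positivity
  have hL := lipC_nonneg d M
  have hsq : ((Nat.sqrt B : ℕ) : ℝ) ≤ √(B : ℝ) := Real.nat_sqrt_le_real_sqrt
  have h3 : (s1.card : ℝ) / x ^ (2 * d + 2) ≤ 1 / M + 1 / x := by
    rw [div_le_iff₀ (by positivity)]
    refine h1.trans ?_
    have e : (1 / (M : ℝ) + 1 / x) * x ^ (2 * d + 2) = (x / M + 1) * x ^ (2 * d + 1) := by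
      field_simp
      ring
    rw [e]
    gcongr
    rw [← mul_div_assoc, hx]
    gcongr
    linarith
  have h4 : (s2.card : ℝ) / x ^ (2 * d + 2) ≤
      2 ^ (d + 1) * ((d * (2 * (lipC d M * B * η + 2) + 1) + 1 + (√(B : ℝ) + 1)) / x) := by
    rw [div_le_iff₀ (by positivity)]
    refine h2.trans ?_
    have e : 2 ^ (d + 1) * ((d * (2 * (lipC d M * B * η + 2) + 1) + 1 + (√(B : ℝ) + 1)) / x)
        * x ^ (2 * d + 2) = (d * (2 * (lipC d M * B * η + 2) + 1) + 1 + (√(B : ℝ) + 1)) *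
          (x ^ d * (2 * x) ^ (d + 1)) := by
      field_simp
      ring
    rw [e]
    gcongr
    rw [hx]; linarith
  have h5 : (d * (2 * (lipC d M * B * η + 2) + 1) + 1 + (√(B : ℝ) + 1)) / x ≤
      d * lipC d M * η + (5 * d + 2) / x + √(B : ℝ) / x := by
    rw [div_le_iff₀ hx0]
    have e : (d * lipC d M * η + (5 * d + 2) / x + √(B : ℝ) / x) * x
        = d * lipC d M * η * x + (5 * d + 2) + √(B : ℝ) := by
      field_simp
    rw [e, hx]
    have : 0 ≤ d * lipC d M * η := by positivity
    nlinarith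
  rw [hsplit]
  push_cast
  rw [add_div]
  have h6 : (2 : ℝ) ^ (d + 1) * ((d * (2 * (lipC d M * B * η + 2) + 1) + 1 + (√(B : ℝ) + 1)) / x)
      ≤ 2 ^ (d + 1) * (d * lipC d M * η + (5 * d + 2) / x + √(B : ℝ) / x) := by gcongr
  calc _ ≤ _ := add_le_add h3 (h4.trans h6)
    _ = _ := by ring

lemma tail_tendsto (a b : ℝ) : Filter.Tendsto (fun B : ℕ => a / (2 * (B : ℝ) + 1)
    + b * (√(B : ℝ) / (2 * B + 1))) Filter.atTop (nhds 0) := by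
  have hlin : Filter.Tendsto (fun B : ℕ => 2 * (B : ℝ) + 1) Filter.atTop Filter.atTop :=
    Filter.tendsto_atTop_add_const_right _ _
      (tendsto_natCast_atTop_atTop.const_mul_atTop two_pos)
  have h1 : Filter.Tendsto (fun B : ℕ => a / (2 * (B : ℝ) + 1)) Filter.atTop (nhds 0) :=
    hlin.const_div_atTop a
  have hs : Filter.Tendsto (fun B : ℕ => √(B : ℝ)) Filter.atTop Filter.atTop :=
    Real.tendsto_sqrt_atTop.comp tendsto_natCast_atTop_atTop
  have h2 : Filter.Tendsto (fun B : ℕ => √(B : ℝ) / (2 * B + 1)) Filter.atTop (nhds 0) := by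
    refine squeeze_zero' (Filter.Eventually.of_forall fun B => by positivity) ?_
      (hs.const_div_atTop 1)
    filter_upwards [Filter.eventually_gt_atTop 0] with B hB
    have hB' : (0 : ℝ) < B := by exact_mod_cast hB
    rw [div_le_div_iff₀ (by positivity) (by positivity), Real.mul_self_sqrt hB'.le]
    linarith
  simpa using h1.add (h2.const_mul b)

lemma bad_tendsto (d : ℕ) (hd : 1 ≤ d) : Filter.Tendsto
    (fun B : ℕ => ((badSet d B).card : ℝ) / (2 * (B : ℝ) + 1) ^ (2 * d + 2))
    Filter.atTop (nhds 0) := by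
  rw [Metric.tendsto_atTop']
  intro ε hε
  obtain ⟨M, hM⟩ := exists_nat_gt (4 / ε)
  have hM0 : (0 : ℝ) < M := lt_trans (by positivity) hM
  have hM1 : 1 ≤ M := by exact_mod_cast hM0
  have hMε : 1 / (M : ℝ) < ε / 4 := by
    rw [div_lt_iff₀ hε] at hM
    rw [div_lt_iff₀ hM0]; linarith
  have hL := lipC_nonneg d M
  set A : ℝ := 2 ^ (d + 1) * (d * lipC d M) with hA
  have hA0 : 0 ≤ A := by positivity
  set η : ℝ := min 1 (ε / 4 / (A + 1)) with hη
  have hη0 : 0 < η := lt_min one_pos (by positivity)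
  have hη1 : η ≤ 1 := min_le_left _ _
  have hAη : A * η ≤ ε / 4 := by
    have h1 : η ≤ ε / 4 / (A + 1) := min_le_right _ _
    rw [le_div_iff₀ (by positivity)] at h1
    nlinarith
  have h1 := (tail_tendsto (1 + 2 ^ (d + 1) * (5 * d + 2)) (2 ^ (d + 1))).eventually
    (gt_mem_nhds (show (0 : ℝ) < ε / 4 by positivity))
  have h2 : ∀ᶠ B : ℕ in Filter.atTop, 2 * (M : ℝ) < B * η ^ d :=
    (tendsto_natCast_atTop_atTop.atTop_mul_const (by positivity)).eventually_gt_atTop _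
  obtain ⟨N, hN⟩ := Filter.eventually_atTop.mp
    ((h1.and h2).and (Filter.eventually_ge_atTop 1))
  refine ⟨N, fun B hB => ?_⟩
  obtain ⟨⟨h1, h2⟩, h3⟩ := hN B hB.le
  have h4 := bad_ratio d B M hd h3 hM1 η hη0 hη1 h2
  rw [Real.dist_eq, sub_zero, abs_of_nonneg (by positivity)]
  have e : 2 ^ (d + 1) * (d * lipC d M * η) = A * η := by rw [hA]; ring
  rw [e] at h4
  linarith

end Final

/-- `#Sur_d(B) / #(P_d(B) × P_d(B)) → 1` as `B → ∞`: almost all quadratic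
polynomials `(x - γ)² + c` with `γ, c ∈ ℤ[t]` of degree at most `d` have surjective arboreal
representations over `ℚ(t)`. -/
theorem stmt_11 (d : ℕ) (hd : 1 ≤ d) :
    Filter.Tendsto
      (fun B : ℕ => (Nat.card (SurSet d B) : ℝ) / (2 * (B : ℝ) + 1) ^ (2 * d + 2))
      Filter.atTop (nhds 1) := by
  have h0 := bad_tendsto d hd
  have h1 : Filter.Tendsto (fun B : ℕ =>
      1 - ((badSet d B).card : ℝ) / (2 * (B : ℝ) + 1) ^ (2 * d + 2)) Filter.atTop (nhds 1) := by
    simpa using h0.const_sub 1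
  refine tendsto_of_tendsto_of_tendsto_of_le_of_le h1 tendsto_const_nhds ?_ ?_
  · intro B
    have h2 := (surSet_card d B hd).2
    have h3 : (2 * (B : ℝ) + 1) ^ (2 * d + 2) ≤ Nat.card (SurSet d B) + (badSet d B).card := by
      exact_mod_cast h2
    have hx : (0 : ℝ) < (2 * (B : ℝ) + 1) ^ (2 * d + 2) := by positivity
    change 1 - ((badSet d B).card : ℝ) / (2 * (B : ℝ) + 1) ^ (2 * d + 2) ≤ _ / _
    rw [sub_le_iff_le_add, ← add_div, le_div_iff₀ hx]
    linarith
  · intro B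
    have h2 := (surSet_card d B hd).1
    have h3 : (Nat.card (SurSet d B) : ℝ) ≤ (2 * (B : ℝ) + 1) ^ (2 * d + 2) := by
      exact_mod_cast h2
    exact div_le_one_of_le₀ h3 (by positivity)
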